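/- arXiv:math/0502458 — 2 statements merged into one kernel-verified Lean document; each statement's English description precedes it below -/
import Mathlib

section
/- Let (X,T,m,d) be a Young tower and f:X→G satisfy Σ_{k,l} m(Δ_{k,l})·Df(Δ_{k,l}) < ∞. If u:X→G is measurable and f = u - u∘T almost everywhere, then u has a version that is Lipschitz on the base Δ_0: there is C>0 such that |u(x)-u(y)| ≤ C·d(x,y) for almost all x,y∈Δ_0. -/
open MeasureTheory Filter ENNReal

variable {X G : Type*}

/-- The essential Lipschitz constant of `f` on the set `Z`. -/
noncomputable def essLip [PseudoEMetricSpace X] [PseudoEMetricSpace G] [MeasurableSpace X]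
    (m : Measure X) (f : X → G) (Z : Set X) : ℝ≥0∞ :=
  sInf {C : ℝ≥0∞ | ∃ Ω : Set X, Ω ⊆ Z ∧ m (Z \ Ω) = 0 ∧
    ∀ x ∈ Ω, ∀ y ∈ Ω, edist (f x) (f y) ≤ C * edist x y}

/-- A Young tower: a partition `{Δ k l : l ∈ ℕ, 0 ≤ k < R l}` of a bounded metric
probability space, `T` moving `Δ k l` isomorphically and measure-preservingly to
`Δ (k+1) l` and sending the top level `Δ (R l - 1) l` isomorphically onto the base
`Δ₀ = ⋃ Δ 0 l`, the return maps to the base being uniformly expanding (factor `lam > 1`),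
with backward contraction constant `C` and bounded distortion of returns. -/
structure YoungTower [MetricSpace X] [MeasurableSpace X]
    (m : Measure X) (T : X → X) (R : ℕ → ℕ) (Δ : ℕ → ℕ → Set X) (lam C : ℝ) : Prop where
  bounded : Bornology.IsBounded (Set.univ : Set X)
  measT : Measurable T
  Rpos : ∀ l, 0 < R l
  meas : ∀ k l, MeasurableSet (Δ k l)
  triv : ∀ k l, R l ≤ k → Δ k l = ∅
  pos : ∀ l, 0 < m (Δ 0 l)
  disj : ∀ k l k' l', (k, l) ≠ (k', l') → Disjoint (Δ k l) (Δ k' l')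
  cover : m (⋃ l, ⋃ k ∈ Finset.range (R l), Δ k l)ᶜ = 0
  step : ∀ l k, k + 1 < R l → Set.BijOn T (Δ k l) (Δ (k+1) l) ∧
      ∀ s : Set X, s ⊆ Δ k l → MeasurableSet s → m (T '' s) = m s
  ret : ∀ l, Set.BijOn T (Δ (R l - 1) l) (⋃ l', Δ 0 l')
  one_lt_lam : 1 < lam
  expand : ∀ l, ∀ x ∈ Δ 0 l, ∀ y ∈ Δ 0 l, lam * dist x y ≤ dist (T^[R l] x) (T^[R l] y)
  Cpos : 0 < C
  back : ∀ l k, k < R l → ∀ x ∈ Δ k l, ∀ y ∈ Δ k l,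
      dist x y ≤ C * dist (T^[R l - k] x) (T^[R l - k] y)
  distortion : ∃ g : X → ℝ, (∀ x, 0 < g x) ∧
      (∀ l, ∀ s : Set X, s ⊆ Δ (R l - 1) l → MeasurableSet s →
        m (T '' s) = ∫⁻ x in s, ENNReal.ofReal (g x)⁻¹ ∂m) ∧
      ∃ C' : ℝ, 0 < C' ∧ ∀ l, ∀ x ∈ Δ (R l - 1) l, ∀ y ∈ Δ (R l - 1) l,
        |1 - g x / g y| ≤ C' * dist (T x) (T y)

/-- Induced system on the base. -/
structure IndSys [MetricSpace X] [MeasurableSpace X]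
    (m : Measure X) (B : Set X) (P : ℕ → Set X) (φ : ℕ → X → X) (θ D0 C1 : NNReal) : Prop where
  mB : MeasurableSet B
  mP : ∀ l, MeasurableSet (P l)
  mφ : ∀ l, Measurable (φ l)
  disj : ∀ l l', l ≠ l' → Disjoint (P l) (P l')
  union : ⋃ l, P l = B
  bij : ∀ l, Set.BijOn (φ l) (P l) B
  contr : ∀ l, ∀ x ∈ P l, ∀ y ∈ P l, dist x y ≤ θ * dist (φ l x) (φ l y)
  θlt : θ < 1
  bound : ∀ x y : X, dist x y ≤ D0
  distort : ∀ l, ∀ r : NNReal, ∀ E : Set X, E ⊆ B → MeasurableSet E →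
    (∀ x ∈ E, ∀ y ∈ E, dist x y ≤ r) → ∃ c : ℝ≥0∞, c ≠ 0 ∧ c ≠ ⊤ ∧
      ∀ E' : Set X, E' ⊆ E → MeasurableSet E' →
        c * m E' ≤ m (P l ∩ φ l ⁻¹' E') ∧
        m (P l ∩ φ l ⁻¹' E') ≤ (((1 + C1 * r)^2 : NNReal) : ℝ≥0∞) * c * m E'
  pos : m B ≠ 0

/-- Cylinders. -/
def cyl (B : Set X) (P : ℕ → Set X) (φ : ℕ → X → X) : List ℕ → Set X
  | [] => B
  | l :: w => P l ∩ φ l ⁻¹' (cyl B P φ w)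

/-- The iterate associated with a word. -/
def itr (φ : ℕ → X → X) : List ℕ → X → X
  | [] => id
  | l :: w => fun x => itr φ w (φ l x)

/-- Lipschitz cost of a word. -/
def cost (θ : NNReal) (D : ℕ → NNReal) : List ℕ → NNReal
  | [] => 0
  | l :: w => D l * θ ^ w.length + cost θ D w

/-- Pullback of a set along a word. -/
def pull (B : Set X) (P : ℕ → Set X) (φ : ℕ → X → X) (w : List ℕ) (A : Set X) : Set X :=
  cyl B P φ w ∩ itr φ w ⁻¹' A

theorem cost_append (θ : NNReal) (D : ℕ → NNReal) (w v : List ℕ) :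
    cost θ D (w ++ v) = θ ^ v.length * cost θ D w + cost θ D v := by
  induction w with
  | nil => simp [cost]
  | cons l w ih => simp only [List.cons_append, cost, ih, List.length_append]; ring

theorem pull_cons (B : Set X) (P : ℕ → Set X) (φ : ℕ → X → X) (l : ℕ) (w : List ℕ) (A : Set X) :
    pull B P φ (l :: w) A = P l ∩ φ l ⁻¹' (pull B P φ w A) := by
  ext x; simp [pull, cyl, itr, and_assoc]

theorem cyl_append (B : Set X) (P : ℕ → Set X) (φ : ℕ → X → X) (w v : List ℕ)
    (hB : cyl B P φ v ⊆ B) :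
    cyl B P φ (w ++ v) = pull B P φ w (cyl B P φ v) := by
  induction w with
  | nil => 
    ext x; simp only [List.nil_append, pull, cyl, itr, Set.mem_inter_iff, Set.mem_preimage, id]
    exact ⟨fun h => ⟨hB h, h⟩, fun h => h.2⟩
  | cons l w ih => rw [pull_cons, ← ih]; rfl

namespace IndSys

variable [MetricSpace X] [MeasurableSpace X] {m : Measure X} {B : Set X} {P : ℕ → Set X}
  {φ : ℕ → X → X} {θ D0 C1 : NNReal}

theorem P_sub (h : IndSys m B P φ θ D0 C1) (l : ℕ) : P l ⊆ B :=
  h.union ▸ Set.subset_iUnion P l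

theorem cyl_sub (h : IndSys m B P φ θ D0 C1) (w : List ℕ) : cyl B P φ w ⊆ B := by
  cases w with
  | nil => exact subset_rfl
  | cons l w => exact Set.inter_subset_left.trans (h.P_sub l)

theorem m_itr (h : IndSys m B P φ θ D0 C1) (w : List ℕ) : Measurable (itr φ w) := by
  induction w with
  | nil => exact measurable_id
  | cons l w ih => exact ih.comp (h.mφ l)

theorem m_cyl (h : IndSys m B P φ θ D0 C1) (w : List ℕ) : MeasurableSet (cyl B P φ w) := by
  induction w with
  | nil => exact h.mB
  | cons l w ih => exact (h.mP l).inter (h.mφ l ih)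

theorem m_pull (h : IndSys m B P φ θ D0 C1) (w : List ℕ) {A : Set X} (hA : MeasurableSet A) :
    MeasurableSet (pull B P φ w A) := (h.m_cyl w).inter (h.m_itr w hA)

theorem itr_bij (h : IndSys m B P φ θ D0 C1) (w : List ℕ) :
    Set.BijOn (itr φ w) (cyl B P φ w) B := by
  induction w with
  | nil => exact Set.bijOn_id B
  | cons l w ih =>
    refine ⟨fun x hx => ih.mapsTo hx.2, fun x hx y hy hxy => ?_, fun z hz => ?_⟩
    · exact (h.bij l).injOn hx.1 hy.1 (ih.injOn hx.2 hy.2 hxy)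
    · obtain ⟨y, hy, rfl⟩ := ih.surjOn hz
      obtain ⟨x, hx, rfl⟩ := (h.bij l).surjOn (h.cyl_sub w hy)
      exact ⟨x, ⟨hx, hy⟩, rfl⟩

theorem itr_contr (h : IndSys m B P φ θ D0 C1) (w : List ℕ) :
    ∀ x ∈ cyl B P φ w, ∀ y ∈ cyl B P φ w,
      dist x y ≤ (θ : ℝ) ^ w.length * dist (itr φ w x) (itr φ w y) := by
  induction w with
  | nil => intro x _ y _; simp [itr]
  | cons l w ih =>
    intro x hx y hy
    calc dist x y ≤ θ * dist (φ l x) (φ l y) := h.contr l x hx.1 y hy.1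
      _ ≤ θ * ((θ : ℝ) ^ w.length * dist (itr φ w (φ l x)) (itr φ w (φ l y))) := by
          gcongr; exact ih _ hx.2 _ hy.2
      _ = _ := by simp only [itr, List.length_cons]; ring

theorem cyl_diam (h : IndSys m B P φ θ D0 C1) (w : List ℕ) :
    ∀ x ∈ cyl B P φ w, ∀ y ∈ cyl B P φ w, dist x y ≤ (θ : ℝ) ^ w.length * D0 := by
  intro x hx y hy
  refine (h.itr_contr w x hx y hy).trans ?_
  gcongr; exact h.bound _ _

theorem exists_cyl (h : IndSys m B P φ θ D0 C1) (n : ℕ) : ∀ x ∈ B, ∃ w : List ℕ,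
    w.length = n ∧ x ∈ cyl B P φ w := by
  induction n with
  | zero => intro x hx; exact ⟨[], rfl, hx⟩
  | succ n ih =>
    intro x hx
    have hx' := hx
    rw [← h.union] at hx'
    obtain ⟨l, hl⟩ := Set.mem_iUnion.1 hx'
    obtain ⟨w, hw, hxw⟩ := ih (φ l x) ((h.bij l).mapsTo hl)
    exact ⟨l :: w, by simp [hw], hl, hxw⟩

theorem cyl_unique (h : IndSys m B P φ θ D0 C1) (w : List ℕ) : ∀ v : List ℕ, ∀ x,
    w.length = v.length → x ∈ cyl B P φ w → x ∈ cyl B P φ v → w = v := by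
  induction w with
  | nil => intro v x hv _ _; exact (List.length_eq_zero_iff.1 hv.symm).symm
  | cons l w ih =>
    intro v x hv hx hx'
    cases v with
    | nil => simp at hv
    | cons l' v =>
      have e : l = l' := by
        by_contra hne
        exact Set.disjoint_left.1 (h.disj l l' hne) hx.1 hx'.1
      subst e
      rw [ih v (φ l x) (by simpa using hv) hx.2 hx'.2]


theorem sum_pull (h : IndSys m B P φ θ D0 C1) (n : ℕ) (E : Set X) (hE : E ⊆ B)
    (hmE : MeasurableSet E) :
    ∑' v : {v : List ℕ // v.length = n}, m (E ∩ cyl B P φ v) = m E := by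
  rw [← measure_iUnion]
  · congr 1
    ext x; simp only [Set.mem_iUnion, Set.mem_inter_iff]
    constructor
    · rintro ⟨_, hx, _⟩; exact hx
    · intro hx
      obtain ⟨w, hw, hxw⟩ := h.exists_cyl n x (hE hx)
      exact ⟨⟨w, hw⟩, hx, hxw⟩
  · intro v v' hne
    refine Set.disjoint_left.2 fun x hx hx' => hne (Subtype.ext ?_)
    exact h.cyl_unique v v' x (v.2.trans v'.2.symm) hx.2 hx'.2
  · exact fun v => hmE.inter (h.m_cyl v)

theorem sum_pull' (h : IndSys m B P φ θ D0 C1) (n : ℕ) (w : List ℕ) (E : Set X)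
    (hmE : MeasurableSet E) :
    ∑' v : {v : List ℕ // v.length = n}, m (E ∩ cyl B P φ (w ++ v)) = m (E ∩ cyl B P φ w) := by
  rw [← measure_iUnion]
  · congr 1
    ext x; simp only [Set.mem_iUnion, Set.mem_inter_iff]
    constructor
    · rintro ⟨v, hx, h'⟩
      rw [cyl_append _ _ _ _ _ (h.cyl_sub _)] at h'
      exact ⟨hx, h'.1⟩
    · rintro ⟨hx, h'⟩
      obtain ⟨v, hv, hxv⟩ := h.exists_cyl n _ ((h.itr_bij w).mapsTo h')
      refine ⟨⟨v, hv⟩, hx, ?_⟩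
      rw [cyl_append _ _ _ _ _ (h.cyl_sub _)]
      exact ⟨h', hxv⟩
  · intro v v' hne
    refine Set.disjoint_left.2 fun x hx hx' => hne (Subtype.ext ?_)
    have := h.cyl_unique (w ++ v) (w ++ v') x (by simp [v.2, v'.2]) hx.2 hx'.2
    exact List.append_cancel_left this
  · exact fun v => hmE.inter (h.m_cyl _)

theorem distort_word (h : IndSys m B P φ θ D0 C1) (w : List ℕ) :
    ∃ c : ℝ≥0∞, c ≠ 0 ∧ c ≠ ⊤ ∧ ∀ A ⊆ B, MeasurableSet A →
      c * m A ≤ m (pull B P φ w A) ∧ m (pull B P φ w A) ≤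
        ((∏ i ∈ Finset.range w.length, (1 + C1 * (θ ^ i * D0)) ^ 2 : NNReal) : ℝ≥0∞) * c * m A := by
  induction w with
  | nil =>
    refine ⟨1, one_ne_zero, one_ne_top, fun A hA _ => ?_⟩
    have : pull B P φ [] A = A := by
      ext x; simp only [pull, cyl, itr, Set.mem_inter_iff, Set.mem_preimage, id]
      exact ⟨fun h => h.2, fun h => ⟨hA h, h⟩⟩
    simp [this]
  | cons l w ih =>
    obtain ⟨c, c0, ct, hc⟩ := ih
    obtain ⟨c', c0', ct', hc'⟩ := h.distort l (θ ^ w.length * D0) (cyl B P φ w) (h.cyl_sub w)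
      (h.m_cyl w) (by simpa using h.cyl_diam w)
    refine ⟨c' * c, mul_ne_zero c0' c0, mul_ne_top ct' ct, fun A hA mA => ?_⟩
    obtain ⟨h1, h2⟩ := hc A hA mA
    obtain ⟨h3, h4⟩ := hc' (pull B P φ w A) Set.inter_subset_left (h.m_pull w mA)
    rw [pull_cons]
    constructor
    · calc c' * c * m A = c' * (c * m A) := by ring
        _ ≤ c' * m (pull B P φ w A) := by gcongr
        _ ≤ _ := h3
    · refine h4.trans ?_
      rw [List.length_cons, Finset.prod_range_succ, ENNReal.coe_mul]
      refine (mul_le_mul_right h2 _).trans (le_of_eq ?_)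
      ring

theorem prod_bound (h : IndSys m B P φ θ D0 C1) : ∃ K : NNReal, ∀ n : ℕ,
    (∏ i ∈ Finset.range n, (1 + C1 * (θ ^ i * D0)) ^ 2 : NNReal) ≤ K := by
  have hs : Summable fun i : ℕ => (C1 * D0 : ℝ) * (θ : ℝ) ^ i :=
    (summable_geometric_of_lt_one θ.2 (by exact_mod_cast h.θlt)).mul_left _
  refine ⟨Real.toNNReal ((Real.exp (∑' i : ℕ, (C1 * D0 : ℝ) * (θ : ℝ) ^ i)) ^ 2), fun n => ?_⟩
  rw [Real.le_toNNReal_iff_coe_le (by positivity), Finset.prod_pow]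
  push_cast
  gcongr
  calc ∏ i ∈ Finset.range n, (1 + (C1:ℝ) * (θ ^ i * D0))
      ≤ ∏ i ∈ Finset.range n, Real.exp ((C1 * D0 : ℝ) * (θ : ℝ) ^ i) := by
        refine Finset.prod_le_prod (fun i _ => by positivity) fun i _ => ?_
        have := Real.add_one_le_exp ((C1 * D0 : ℝ) * (θ : ℝ) ^ i)
        linarith
    _ = Real.exp (∑ i ∈ Finset.range n, (C1 * D0 : ℝ) * (θ : ℝ) ^ i) := (Real.exp_sum _ _).symm
    _ ≤ _ := by
      gcongr
      exact hs.sum_le_tsum _ fun i _ => by positivity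

theorem pull_B (h : IndSys m B P φ θ D0 C1) (w : List ℕ) : pull B P φ w B = cyl B P φ w :=
  Set.inter_eq_left.2 (h.itr_bij w).mapsTo

theorem distort_unif [IsFiniteMeasure m] (h : IndSys m B P φ θ D0 C1) : ∃ K : ℝ≥0∞, K ≠ ⊤ ∧ K ≠ 0 ∧
    ∀ w, ∀ A ⊆ B, MeasurableSet A →
      m (pull B P φ w A) ≤ K * m (cyl B P φ w) * m A ∧
      m (cyl B P φ w) * m A ≤ K * m (pull B P φ w A) := by
  obtain ⟨K, hK⟩ := h.prod_bound
  have hB := h.pos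
  have hBt : m B ≠ ⊤ := measure_ne_top m B
  have hK1 : 1 ≤ K := by simpa using hK 0
  refine ⟨K * (m B)⁻¹ + K * m B, ?_, ?_, fun w A hA mA => ?_⟩
  · finiteness
  · have : (K : ℝ≥0∞) ≠ 0 := by
      have : 0 < K := lt_of_lt_of_le zero_lt_one hK1
      exact_mod_cast this.ne'
    simp [this, hB]
  obtain ⟨c, c0, ct, hc⟩ := h.distort_word w
  obtain ⟨h1, h2⟩ := hc A hA mA
  obtain ⟨h3, h4⟩ := hc B subset_rfl h.mB
  rw [h.pull_B] at h3 h4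
  have hKw : ((∏ i ∈ Finset.range w.length, (1 + C1 * (θ ^ i * D0)) ^ 2 : NNReal) : ℝ≥0∞) ≤ K := by
    exact_mod_cast hK w.length
  constructor
  · calc m (pull B P φ w A) ≤ K * c * m A := h2.trans (by gcongr)
      _ = K * (m B)⁻¹ * (c * m B) * m A := by
        rw [show K * (m B)⁻¹ * (c * m B) * m A = K * c * m A * ((m B)⁻¹ * m B) by ring,
          ENNReal.inv_mul_cancel hB hBt, mul_one]
      _ ≤ (K * (m B)⁻¹ + K * m B) * m (cyl B P φ w) * m A := by
        gcongr; exact le_self_add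
  · calc m (cyl B P φ w) * m A ≤ (K * c * m B) * m A := by
          gcongr; exact h4.trans (by gcongr)
      _ = K * m B * (c * m A) := by ring
      _ ≤ (K * (m B)⁻¹ + K * m B) * m (pull B P φ w A) := by
        gcongr; exact le_add_self

theorem cyl_pos (h : IndSys m B P φ θ D0 C1) (w : List ℕ) : m (cyl B P φ w) ≠ 0 := by
  obtain ⟨c, c0, ct, hc⟩ := h.distort_word w
  have := (hc B subset_rfl h.mB).1
  rw [h.pull_B] at this
  intro h0
  rw [h0] at this
  simp [c0, h.pos] at this

theorem pull_null [IsFiniteMeasure m] (h : IndSys m B P φ θ D0 C1) (w : List ℕ) (A : Set X)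
    (hA : A ⊆ B) (mA : MeasurableSet A) (h0 : m A = 0) : m (pull B P φ w A) = 0 := by
  obtain ⟨c, c0, ct, hc⟩ := h.distort_word w
  have := (hc A hA mA).2
  simpa [h0] using this

theorem m_image [BorelSpace X] (h : IndSys m B P φ θ D0 C1) (w : List ℕ) (Y : Set X)
    (mY : MeasurableSet Y) : MeasurableSet (itr φ w '' (cyl B P φ w ∩ Y)) := by
  have hs : ∀ z : B, ∃ x ∈ cyl B P φ w, itr φ w x = z := fun z => (h.itr_bij w).surjOn z.2
  choose ψ hψ1 hψ2 using hs
  have hL : LipschitzWith 1 ψ := by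
    refine LipschitzWith.of_dist_le_mul fun z z' => ?_
    have := h.itr_contr w _ (hψ1 z) _ (hψ1 z')
    rw [hψ2, hψ2] at this
    refine this.trans ?_
    rw [Subtype.dist_eq]
    gcongr
    have : (θ:ℝ) ≤ 1 := by exact_mod_cast h.θlt.le
    simpa using pow_le_one₀ θ.2 this
  have := h.mB.subtype_image (hL.continuous.measurable mY)
  convert this using 1
  ext z
  constructor
  · rintro ⟨x, ⟨hx, hxY⟩, rfl⟩
    have hz := (h.itr_bij w).mapsTo hx
    refine ⟨⟨_, hz⟩, ?_, rfl⟩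
    have : ψ ⟨_, hz⟩ = x := (h.itr_bij w).injOn (hψ1 _) hx (hψ2 _)
    simpa [this] using hxY
  · rintro ⟨z, hz, rfl⟩
    exact ⟨ψ z, ⟨hψ1 z, hz⟩, hψ2 z⟩

theorem density [BorelSpace X] [IsFiniteMeasure m] (h : IndSys m B P φ θ D0 C1) (A : Set X)
    (hA : A ⊆ B) (mA : MeasurableSet A) (h0 : m A ≠ 0) (δ : ℝ≥0∞) (hδ : δ ≠ 0) :
    ∃ w, m (cyl B P φ w \ A) ≤ δ * m (cyl B P φ w) := by
  by_contra! hcon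
  have hAt : m A ≠ ⊤ := measure_ne_top m A
  wlog hδt : δ ≠ ⊤ generalizing δ
  · exact this 1 one_ne_zero (fun w => lt_of_le_of_lt (by gcongr; simp at hδt; simp [hδt]) (hcon w))
      one_ne_top
  obtain ⟨U, hAU, hU, hmU⟩ := A.exists_isOpen_lt_add (μ := m) hAt
    (ε := δ * (m A / 2)) (mul_ne_zero hδ (by simp [h0]))
  have hUA : m (U \ A) < δ * (m A / 2) := by
    rw [measure_sdiff hAU mA.nullMeasurableSet hAt]
    exact ENNReal.sub_lt_of_lt_add (measure_mono hAU) (by rwa [add_comm])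
  set V : ℕ → Set X := fun n => {x | x ∈ B ∧ Metric.closedBall x ((θ:ℝ) ^ n * D0) ⊆ U} with hV
  have hθ : (θ : ℝ) < 1 := by exact_mod_cast h.θlt
  have hVm : Monotone V := by
    intro n k hnk x hx
    refine ⟨hx.1, (Metric.closedBall_subset_closedBall ?_).trans hx.2⟩
    gcongr ?_ * _
    exact pow_le_pow_of_le_one θ.2 hθ.le hnk
  have hAV : A ⊆ ⋃ n, V n := by
    intro x hx
    obtain ⟨ε, hε, hb⟩ := Metric.isOpen_iff.1 hU x (hAU hx)
    have ht : Tendsto (fun n : ℕ => (θ:ℝ) ^ n * D0) atTop (nhds (0 * D0)) :=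
      (tendsto_pow_atTop_nhds_zero_of_lt_one θ.2 hθ).mul_const _
    rw [zero_mul] at ht
    obtain ⟨n, hn⟩ := (ht.eventually (gt_mem_nhds hε)).exists
    refine Set.mem_iUnion.2 ⟨n, hA hx, (Metric.closedBall_subset_ball hn).trans hb⟩
  have hlt : m A / 2 < ⨆ n, m (V n) := by
    rw [← hVm.measure_iUnion]
    exact (ENNReal.half_lt_self h0 hAt).trans_le (measure_mono hAV)
  obtain ⟨n, hn⟩ := lt_iSup_iff.1 hlt
  set U' : Set X := ⋃ v : {v : List ℕ // v.length = n ∧ cyl B P φ v ⊆ U}, cyl B P φ v with hU'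
  have hdis : Pairwise (Function.onFun Disjoint
      fun v : {v : List ℕ // v.length = n ∧ cyl B P φ v ⊆ U} => cyl B P φ v) := by
    intro v v' hne
    refine Set.disjoint_left.2 fun x hx hx' => hne (Subtype.ext ?_)
    exact h.cyl_unique v v' x (v.2.1.trans v'.2.1.symm) hx hx'
  have h1 : V n ⊆ U' := by
    intro x hx
    obtain ⟨w, hw, hxw⟩ := h.exists_cyl n x hx.1
    refine Set.mem_iUnion.2 ⟨⟨w, hw, fun y hy => hx.2 ?_⟩, hxw⟩
    have := h.cyl_diam w y hy x hxw
    rwa [hw] at this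
  have h2 : δ * m U' ≤ m (U' \ A) := by
    rw [hU', measure_iUnion hdis (fun v => h.m_cyl v), Set.iUnion_sdiff, measure_iUnion,
      ← ENNReal.tsum_mul_left]
    · exact ENNReal.tsum_le_tsum fun v => (hcon v).le
    · exact fun v v' hne => (hdis hne).mono Set.sdiff_subset Set.sdiff_subset
    · exact fun v => (h.m_cyl v).diff mA
  have h3 : U' ⊆ U := Set.iUnion_subset fun v => v.2.2
  have : δ * (m A / 2) ≤ m (U \ A) := by
    calc δ * (m A / 2) ≤ δ * m U' := by gcongr; exact hn.le.trans (measure_mono h1)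
      _ ≤ _ := h2
      _ ≤ _ := by gcongr
  exact absurd hUA (not_lt.2 this)


theorem cost_sum [IsProbabilityMeasure m] (h : IndSys m B P φ θ D0 C1) (D : ℕ → NNReal)
    (hD : ∑' l, m (P l) * D l ≠ ⊤) : ∃ M : NNReal, ∀ n : ℕ,
    ∑' w : {w : List ℕ // w.length = n}, m (cyl B P φ w) * cost θ D w ≤ M := by
  obtain ⟨K, hKt, hK0, hK⟩ := h.distort_unif
  obtain ⟨q, hq⟩ : ∃ q : NNReal, (q : ℝ≥0∞) = K * ∑' l, m (P l) * D l :=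
    ⟨_, ENNReal.coe_toNNReal (mul_ne_top hKt hD)⟩
  refine ⟨q / (1 - θ), fun n => ?_⟩
  have hθ : 1 - θ ≠ 0 := (tsub_pos_of_lt h.θlt).ne'
  have hM : θ * (q / (1 - θ)) + q = q / (1 - θ) := by
    have h1 : (1 - θ) + θ = 1 := tsub_add_cancel_of_le h.θlt.le
    have h2 : q = (1 - θ) * (q / (1 - θ)) := by field_simp
    calc θ * (q / (1 - θ)) + q = θ * (q / (1 - θ)) + (1 - θ) * (q / (1 - θ)) := by rw [← h2]
      _ = ((1 - θ) + θ) * (q / (1 - θ)) := by ring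
      _ = _ := by rw [h1, one_mul]
  induction n with
  | zero =>
    have : ∀ w : {w : List ℕ // w.length = 0}, m (cyl B P φ w) * cost θ D w = 0 := by
      rintro ⟨w, hw⟩
      rw [List.length_eq_zero_iff] at hw
      subst hw
      simp [cost]
    simp [this]
  | succ n ih =>
    set j : {w : List ℕ // w.length = n + 1} → {w : List ℕ // w.length = n} × ℕ := fun w =>
      (⟨w.1.dropLast, by simp [w.2]⟩, w.1.getLast (by intro h0; have := w.2; simp [h0] at this)) with hj
    have hjw : ∀ w, (j w).1.1 ++ [(j w).2] = w.1 := fun w => List.dropLast_append_getLast _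
    have hji : Function.Injective j := by
      intro w w' e
      apply Subtype.ext
      rw [← hjw w, ← hjw w', e]
    set F : {w : List ℕ // w.length = n} × ℕ → ℝ≥0∞ := fun p =>
      m (cyl B P φ (p.1.1 ++ [p.2])) * cost θ D (p.1.1 ++ [p.2]) with hF
    have hcs : ∀ l, cyl B P φ [l] = P l := fun l => Set.inter_eq_left.2 (h.bij l).mapsTo
    calc ∑' w : {w : List ℕ // w.length = n + 1}, m (cyl B P φ w) * cost θ D w
        = ∑' w, F (j w) := by simp only [hF, hjw]
      _ ≤ ∑' p, F p := ENNReal.tsum_comp_le_tsum_of_injective hji F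
      _ = ∑' w : {w : List ℕ // w.length = n}, ∑' l, F (w, l) := ENNReal.tsum_prod'
      _ ≤ ∑' w : {w : List ℕ // w.length = n}, (θ * (m (cyl B P φ w) * cost θ D w) +
            m (B ∩ cyl B P φ w) * q) := by
          refine ENNReal.tsum_le_tsum fun w => ?_
          calc ∑' l, F (w, l) = ∑' l, (m (pull B P φ w (P l)) * (θ * cost θ D w) +
                  m (pull B P φ w (P l)) * D l) := by
                refine tsum_congr fun l => ?_
                simp only [hF]
                rw [cyl_append _ _ _ _ _ (h.cyl_sub _), cost_append, hcs]
                simp [cost, mul_add]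
            _ = (∑' l, m (pull B P φ w (P l))) * (θ * cost θ D w) +
                  ∑' l, m (pull B P φ w (P l)) * D l := by
                rw [ENNReal.tsum_add, ENNReal.tsum_mul_right]
            _ ≤ m (cyl B P φ w) * (θ * cost θ D w) +
                  ∑' l, (K * m (cyl B P φ w)) * (m (P l) * D l) := by
                refine add_le_add (mul_le_mul_left ?_ _) (ENNReal.tsum_le_tsum fun l => ?_)
                · rw [← measure_iUnion]
                  · exact measure_mono (Set.iUnion_subset fun l => Set.inter_subset_left)
                  · intro l l' hne
                    exact ((h.disj l l' hne).preimage _).mono Set.inter_subset_right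
                      Set.inter_subset_right
                  · exact fun l => h.m_pull w (h.mP l)
                · rw [← mul_assoc]
                  gcongr
                  exact (hK w _ (h.P_sub l) (h.mP l)).1
            _ = _ := by
                rw [ENNReal.tsum_mul_left, Set.inter_eq_right.2 (h.cyl_sub _), hq]
                ring
      _ = θ * (∑' w : {w : List ℕ // w.length = n}, m (cyl B P φ w) * cost θ D w) + m B * q := by
          rw [ENNReal.tsum_add, ENNReal.tsum_mul_left, ENNReal.tsum_mul_right,
            h.sum_pull n B subset_rfl h.mB]
      _ ≤ θ * ((q / (1 - θ) : NNReal) : ℝ≥0∞) + 1 * q := by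
          gcongr
          exact prob_le_one
      _ = _ := by rw [one_mul]; exact_mod_cast hM

theorem choose_word [BorelSpace X] [IsProbabilityMeasure m] (h : IndSys m B P φ θ D0 C1)
    (D : ℕ → NNReal) (hD : ∑' l, m (P l) * D l ≠ ⊤) : ∃ M : NNReal, ∀ A ⊆ B, MeasurableSet A →
    m A ≠ 0 → ∀ δ : ℝ≥0∞, δ ≠ 0 → δ ≠ ⊤ →
    ∃ w, m (cyl B P φ w \ A) ≤ δ * m (cyl B P φ w) ∧ cost θ D w ≤ M := by
  obtain ⟨K, hKt, hK0, hK⟩ := h.distort_unif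
  lift K to NNReal using hKt
  obtain ⟨M0, hM0⟩ := h.cost_sum D hD
  set M1 : NNReal := 4 * (K * M0) + 1 with hM1
  refine ⟨1 + M1, fun A hA mA hA0 δ hδ hδt => ?_⟩
  obtain ⟨w, hw⟩ := h.density A hA mA hA0 (δ / 4) (by simp [hδ])
  have hθ : (θ : ℝ) < 1 := by exact_mod_cast h.θlt
  have ht : Tendsto (fun n : ℕ => θ ^ n * cost θ D w) atTop (nhds (0 * cost θ D w)) :=
    (tendsto_pow_atTop_nhds_zero_of_lt_one (zero_le) h.θlt).mul_const _
  rw [zero_mul] at ht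
  obtain ⟨p, hp⟩ := (ht.eventually (gt_mem_nhds zero_lt_one)).exists
  by_contra! hcon
  have M10 : (M1 : ℝ≥0∞) ≠ 0 := by
    have : M1 ≠ 0 := by positivity
    exact_mod_cast this
  have key : ∀ v : {v : List ℕ // v.length = p}, m (Set.univ ∩ cyl B P φ (w ++ v)) ≤
      δ⁻¹ * m (Aᶜ ∩ cyl B P φ (w ++ v)) +
        (M1 : ℝ≥0∞)⁻¹ * (K * m (cyl B P φ w)) * (m (cyl B P φ v) * cost θ D v) := by
    intro v
    rw [Set.univ_inter]
    by_cases hc : m (cyl B P φ (w ++ v) \ A) ≤ δ * m (cyl B P φ (w ++ v))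
    · have h1 := hcon _ hc
      rw [cost_append, v.2] at h1
      have h2 : M1 ≤ cost θ D v := by
        by_contra! h3
        exact absurd h1 (not_lt.2 (add_le_add hp.le h3.le))
      refine le_trans ?_ le_add_self
      have h4 := (hK w _ (h.cyl_sub v) (h.m_cyl v)).1
      rw [← cyl_append _ _ _ _ _ (h.cyl_sub v)] at h4
      calc m (cyl B P φ (w ++ v)) = (M1 : ℝ≥0∞)⁻¹ * M1 * m (cyl B P φ (w ++ v)) := by
            rw [ENNReal.inv_mul_cancel M10 coe_ne_top, one_mul]
        _ ≤ (M1 : ℝ≥0∞)⁻¹ * cost θ D v * (K * m (cyl B P φ w) * m (cyl B P φ v)) := by gcongr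
        _ = _ := by ring
    · push Not at hc
      refine le_trans ?_ le_self_add
      rw [Set.inter_comm, ← Set.sdiff_eq]
      calc m (cyl B P φ (w ++ v)) = δ⁻¹ * (δ * m (cyl B P φ (w ++ v))) := by
            rw [← mul_assoc, ENNReal.inv_mul_cancel hδ hδt, one_mul]
        _ ≤ _ := by gcongr
  have hs := ENNReal.tsum_le_tsum key
  rw [h.sum_pull' p w _ MeasurableSet.univ, ENNReal.tsum_add, ENNReal.tsum_mul_left,
    ENNReal.tsum_mul_left, h.sum_pull' p w _ mA.compl, Set.univ_inter, Set.inter_comm,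
    ← Set.sdiff_eq] at hs
  set c := m (cyl B P φ w) with hc
  have hc0 : c ≠ 0 := h.cyl_pos w
  have hct : c ≠ ⊤ := measure_ne_top _ _
  have e1 : δ⁻¹ * m (cyl B P φ w \ A) ≤ 4⁻¹ * c := by
    calc δ⁻¹ * m (cyl B P φ w \ A) ≤ δ⁻¹ * (δ / 4 * c) := by gcongr
      _ = (δ⁻¹ * δ) * (4⁻¹ * c) := by rw [div_eq_mul_inv]; ring
      _ = _ := by rw [ENNReal.inv_mul_cancel hδ hδt, one_mul]
  have e3 : (M1 : ℝ≥0∞)⁻¹ * (K * M0) ≤ 4⁻¹ := by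
    have : (M1⁻¹ * (K * M0) : NNReal) ≤ 4⁻¹ := by
      rw [inv_mul_le_iff₀ (by positivity), hM1]
      rw [← div_eq_mul_inv, le_div_iff₀ (by positivity)]
      rw [mul_comm]
      exact le_self_add
    have h5 : ((M1⁻¹ * (K * M0) : NNReal) : ℝ≥0∞) ≤ ((4⁻¹ : NNReal) : ℝ≥0∞) := by exact_mod_cast this
    rw [ENNReal.coe_mul, ENNReal.coe_inv (by positivity), ENNReal.coe_inv (by norm_num)] at h5
    simpa using h5
  have e2 : (M1 : ℝ≥0∞)⁻¹ * (K * c) * ∑' v : {v : List ℕ // v.length = p},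
      (m (cyl B P φ v) * cost θ D v) ≤ 4⁻¹ * c := by
    calc _ ≤ (M1 : ℝ≥0∞)⁻¹ * (K * c) * M0 := by gcongr; exact hM0 p
      _ = (M1 : ℝ≥0∞)⁻¹ * (K * M0) * c := by ring
      _ ≤ _ := by gcongr
  have h6 : c ≤ 4⁻¹ * c + 4⁻¹ * c := hs.trans (add_le_add e1 e2)
  have h7 : (4⁻¹ : ℝ≥0∞) * c + 4⁻¹ * c = c / 2 := by
    rw [← add_mul, mul_comm, div_eq_mul_inv]
    congr 1
    rw [show (4 : ℝ≥0∞) = 2 * 2 by norm_num, ENNReal.mul_inv (by simp) (by simp), ← mul_add,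
      ENNReal.inv_two_add_inv_two, mul_one]
  rw [h7] at h6
  exact absurd h6 (not_le.2 (ENNReal.half_lt_self hc0 hct))

theorem good_null (h : IndSys m B P φ θ D0 C1) (Ω : ℕ → Set X) (hΩm : ∀ l, MeasurableSet (Ω l))
    (hΩ0 : ∀ l, m (P l \ Ω l) = 0) (w : List ℕ) :
    MeasurableSet (cyl B Ω φ w) ∧ m (cyl B P φ w \ cyl B Ω φ w) = 0 := by
  induction w with
  | nil => simp [cyl, h.mB]
  | cons l w ih =>
    refine ⟨(hΩm l).inter (h.mφ l ih.1), ?_⟩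
    set E := cyl B P φ w \ cyl B Ω φ w with hE
    have mE : MeasurableSet E := (h.m_cyl w).diff ih.1
    obtain ⟨c, c0, ct, hc⟩ := h.distort l D0 E (Set.sdiff_subset.trans (h.cyl_sub w)) mE
      (fun x _ y _ => h.bound x y)
    have h0 := (hc E subset_rfl mE).2
    rw [ih.2, mul_zero, nonpos_iff_eq_zero] at h0
    refine measure_mono_null ?_ (measure_union_null (hΩ0 l) h0)
    rintro x ⟨⟨hx1, hx2⟩, hx3⟩
    by_cases hx : x ∈ Ω l
    · right; exact ⟨hx1, hx2, fun h' => hx3 ⟨hx, h'⟩⟩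
    · left; exact ⟨hx1, hx⟩

theorem good_sub (Ω : ℕ → Set X) (hΩ : ∀ l, Ω l ⊆ P l) (w : List ℕ) :
    cyl B Ω φ w ⊆ cyl B P φ w := by
  induction w with
  | nil => exact subset_rfl
  | cons l w ih => exact Set.inter_subset_inter (hΩ l) (Set.preimage_mono ih)

theorem good_lip [NormedAddCommGroup G] (h : IndSys m B P φ θ D0 C1) (Ω : ℕ → Set X)
    (hΩ : ∀ l, Ω l ⊆ P l) (D : ℕ → NNReal) (u : X → G)
    (hu : ∀ l, ∀ x ∈ Ω l, ∀ y ∈ Ω l,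
      dist (u x - u (φ l x)) (u y - u (φ l y)) ≤ D l * dist (φ l x) (φ l y)) (w : List ℕ) :
    ∀ x ∈ cyl B Ω φ w, ∀ y ∈ cyl B Ω φ w,
      dist (u x - u (itr φ w x)) (u y - u (itr φ w y)) ≤
        cost θ D w * dist (itr φ w x) (itr φ w y) := by
  induction w with
  | nil => intro x _ y _; simp [itr, cost]
  | cons l w ih =>
    intro x hx y hy
    have e : ∀ x, u x - u (itr φ (l :: w) x) =
      (u x - u (φ l x)) + (u (φ l x) - u (itr φ w (φ l x))) := by intro x; simp [itr]
    rw [e, e]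
    refine (dist_add_add_le _ _ _ _).trans ?_
    have h1 := ih _ hx.2 _ hy.2
    have h2 := hu l x hx.1 y hy.1
    have h3 := h.itr_contr w _ (good_sub Ω hΩ w hx.2) _ (good_sub Ω hΩ w hy.2)
    have h4 : (D l : ℝ) * dist (φ l x) (φ l y) ≤
        D l * ((θ : ℝ) ^ w.length * dist (itr φ w (φ l x)) (itr φ w (φ l y))) := by gcongr
    simp only [cost, itr]
    push_cast
    linarith

theorem ergodic' [BorelSpace X] [IsProbabilityMeasure m] (h : IndSys m B P φ θ D0 C1) (Ω : ℕ → Set X)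
    (hΩm : ∀ l, MeasurableSet (Ω l))
    (hΩ0 : ∀ l, m (P l \ Ω l) = 0) (E : Set X) (hE : E ⊆ B) (mE : MeasurableSet E)
    (hinv : ∀ l, ∀ x ∈ Ω l, x ∈ E ↔ φ l x ∈ E) : m E = 0 ∨ m (B \ E) = 0 := by
  by_cases h0 : m E = 0
  · exact Or.inl h0
  right
  obtain ⟨K, hKt, hK0, hK⟩ := h.distort_unif
  have hw : ∀ w, ∀ x ∈ cyl B Ω φ w, x ∈ E ↔ itr φ w x ∈ E := by
    intro w
    induction w with
    | nil => intro x _; rfl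
    | cons l w ih => intro x hx; exact (hinv l x hx.1).trans (ih _ hx.2)
  have key : ∀ δ : ℝ≥0∞, δ ≠ 0 → m (B \ E) ≤ K * δ := by
    intro δ hδ
    obtain ⟨w, hw'⟩ := h.density E hE mE h0 δ hδ
    have h2 := (hK w (B \ E) Set.sdiff_subset (h.mB.diff mE)).2
    have h3 : m (pull B P φ w (B \ E)) ≤ m (cyl B P φ w \ E) := by
      calc _ ≤ m ((cyl B P φ w \ E) ∪ (cyl B P φ w \ cyl B Ω φ w)) := by
            refine measure_mono ?_
            rintro x ⟨hx, hx2⟩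
            by_cases hg : x ∈ cyl B Ω φ w
            · left; exact ⟨hx, fun h' => hx2.2 ((hw w x hg).1 h')⟩
            · right; exact ⟨hx, hg⟩
        _ ≤ _ := (measure_union_le _ _).trans (by rw [(h.good_null Ω hΩm hΩ0 w).2, add_zero])
    have h4 : m (cyl B P φ w) * m (B \ E) ≤ m (cyl B P φ w) * (K * δ) := by
      calc _ ≤ _ := h2
        _ ≤ K * (δ * m (cyl B P φ w)) := by gcongr; exact h3.trans hw'
        _ = _ := by ring
    exact (ENNReal.mul_le_mul_iff_right (h.cyl_pos w) (measure_ne_top _ _)).1 h4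
  by_contra hne
  have hBE : m (B \ E) ≠ ⊤ := measure_ne_top _ _
  have := key (m (B \ E) / 2 / K) (by simp [hne, hKt])
  rw [ENNReal.mul_div_cancel hK0 hKt] at this
  exact absurd this (not_le.2 (ENNReal.half_lt_self hne hBE))


theorem small_set [BorelSpace X] [IsProbabilityMeasure m] [NormedAddCommGroup G]
    [MeasurableSpace G] [BorelSpace G] [LocallyCompactSpace G]
    (h : IndSys m B P φ θ D0 C1) (Ω : ℕ → Set X)
    (hΩm : ∀ l, MeasurableSet (Ω l)) (hΩ : ∀ l, Ω l ⊆ P l)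
    (hΩ0 : ∀ l, m (P l \ Ω l) = 0) (D : ℕ → NNReal) (u : X → G) (mu : Measurable u)
    (hu : ∀ l, ∀ x ∈ Ω l, ∀ y ∈ Ω l,
      dist (u x - u (φ l x)) (u y - u (φ l y)) ≤ D l * dist (φ l x) (φ l y))
    (ε : ℝ) (hε : 0 < ε) :
    ∃ A ⊆ B, MeasurableSet A ∧ m A ≠ 0 ∧ ∀ x ∈ A, ∀ y ∈ A, dist (u x) (u y) ≤ ε := by
  classical
  have hθ : (θ : ℝ) < 1 := by exact_mod_cast h.θlt
  obtain ⟨Kc, hKc, hK0⟩ := exists_compact_mem_nhds (0 : G)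
  obtain ⟨r, hr, hrK⟩ := Metric.nhds_basis_closedBall.mem_iff.1 hK0
  -- countable set of values
  set val : ℕ × List ℕ → G := fun p =>
    if hp : ∃ x ∈ Ω p.1, φ p.1 x ∈ cyl B P φ p.2 then
      u hp.choose - u (φ p.1 hp.choose) else 0 with hval
  set S : Set G := Set.range val ∪ Kc with hS
  set H : AddSubgroup G := (Submodule.span ℤ S).toAddSubgroup with hH
  have hSH : S ⊆ H := Submodule.subset_span
  have hsep : TopologicalSpace.IsSeparable (H : Set G) := by
    have : TopologicalSpace.IsSeparable S :=
      (Set.countable_range val).isSeparable.union hKc.isSeparable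
    exact TopologicalSpace.IsSeparable.span (R := ℤ) this
  have hopen : IsOpen (H : Set G) :=
    H.isOpen_of_mem_nhds (Filter.mem_of_superset hK0 (Set.subset_union_right.trans hSH))
  have hdiff : ∀ l, ∀ x ∈ Ω l, u x - u (φ l x) ∈ H := by
    intro l x hx
    have ht : Tendsto (fun n : ℕ => (D l : ℝ) * ((θ:ℝ) ^ n * D0)) atTop (nhds (D l * (0 * D0))) :=
      ((tendsto_pow_atTop_nhds_zero_of_lt_one θ.2 hθ).mul_const _).const_mul _
    rw [zero_mul, mul_zero] at ht
    obtain ⟨n, hn⟩ := (ht.eventually (gt_mem_nhds hr)).exists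
    obtain ⟨w, hw, hxw⟩ := h.exists_cyl n (φ l x) ((h.bij l).mapsTo (hΩ l hx))
    have hp : ∃ x ∈ Ω l, φ l x ∈ cyl B P φ w := ⟨x, hx, hxw⟩
    have hv : val (l, w) = u hp.choose - u (φ l hp.choose) := by
      simp only [hval]; rw [dif_pos hp]
    have hvH : val (l, w) ∈ H := hSH (Or.inl ⟨_, rfl⟩)
    have hd : dist (u x - u (φ l x)) (val (l, w)) ≤ r := by
      rw [hv]
      refine (hu l x hx _ hp.choose_spec.1).trans (le_trans ?_ hn.le)
      gcongr
      rw [← hw]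
      exact h.cyl_diam w _ hxw _ hp.choose_spec.2
    have hm : (u x - u (φ l x)) - val (l, w) ∈ H := by
      refine hSH (Or.inr (hrK ?_))
      rw [mem_closedBall_zero_iff, ← dist_eq_norm]; exact hd
    have := H.add_mem hm hvH
    simpa using this
  -- cosets
  have hBne : B.Nonempty := nonempty_of_measure_ne_zero h.pos
  obtain ⟨b, hb⟩ := hBne
  set τ : G ⧸ H → X := fun c =>
    if hc : ∃ x ∈ B, (QuotientAddGroup.mk (u x) : G ⧸ H) = c then hc.choose else b with hτ
  have hτB : ∀ c, τ c ∈ B := by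
    intro c
    simp only [hτ]
    split_ifs with hc
    · exact hc.choose_spec.1
    · exact hb
  have hτu : ∀ x ∈ B, (QuotientAddGroup.mk (u (τ (QuotientAddGroup.mk (u x)))) : G ⧸ H) =
      QuotientAddGroup.mk (u x) := by
    intro x hx
    have hc : ∃ y ∈ B, (QuotientAddGroup.mk (u y) : G ⧸ H) = QuotientAddGroup.mk (u x) :=
      ⟨x, hx, rfl⟩
    simp only [hτ]; rw [dif_pos hc]
    exact hc.choose_spec.2
  have hdisc : DiscreteTopology (G ⧸ H) := QuotientAddGroup.discreteTopology hopen
  set E : List ℕ → Set X := fun w =>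
    B ∩ u ⁻¹' ((QuotientAddGroup.mk : G → G ⧸ H) ⁻¹' (τ ⁻¹' (cyl B P φ w))) with hE
  have mE : ∀ w, MeasurableSet (E w) := by
    intro w
    refine h.mB.inter (mu ?_)
    exact ((isOpen_discrete _).preimage QuotientAddGroup.continuous_mk).measurableSet
  have herg : ∀ w, m (E w) = 0 ∨ m (B \ E w) = 0 := by
    intro w
    refine h.ergodic' Ω hΩm hΩ0 (E w) Set.inter_subset_left (mE w) fun l x hx => ?_
    have hxB : x ∈ B := h.P_sub l (hΩ l hx)
    have hxB' : φ l x ∈ B := (h.bij l).mapsTo (hΩ l hx)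
    have e : (QuotientAddGroup.mk (u x) : G ⧸ H) = QuotientAddGroup.mk (u (φ l x)) := by
      rw [eq_comm, QuotientAddGroup.eq, neg_add_eq_sub]
      exact hdiff l x hx
    simp only [hE, Set.mem_inter_iff, Set.mem_preimage, e, hxB, hxB', true_and]
  -- the exceptional set
  set N : Set X := ⋃ w, if m (E w) = 0 then E w else B \ E w with hN
  have hN0 : m N = 0 := by
    refine measure_iUnion_null fun w => ?_
    split_ifs with h0
    · exact h0
    · exact (herg w).resolve_left h0
  have hNiff : ∀ x ∈ B, x ∉ N → ∀ w, x ∈ E w ↔ m (E w) ≠ 0 := by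
    intro x hx hxN w
    have hxw : x ∉ (if m (E w) = 0 then E w else B \ E w) := fun h' => hxN (Set.mem_iUnion.2 ⟨w, h'⟩)
    split_ifs at hxw with h0
    · simp [h0, hxw]
    · simp only [h0, ne_eq, not_false_eq_true, iff_true]
      by_contra hcon
      exact hxw ⟨hx, hcon⟩
  have hBN : m (B \ N) ≠ 0 := by
    rw [measure_sdiff_null hN0]; exact h.pos
  obtain ⟨x0, hx0, hx0N⟩ := nonempty_of_measure_ne_zero hBN
  have hcoset : ∀ x ∈ B, x ∉ N → u x - u x0 ∈ H := by
    intro x hx hxN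
    have hτeq : τ (QuotientAddGroup.mk (u x)) = τ (QuotientAddGroup.mk (u x0)) := by
      refine dist_le_zero.1 ?_
      have ht : Tendsto (fun n : ℕ => (θ:ℝ) ^ n * D0) atTop (nhds (0 * D0)) :=
        (tendsto_pow_atTop_nhds_zero_of_lt_one θ.2 hθ).mul_const _
      rw [zero_mul] at ht
      refine ge_of_tendsto' ht fun n => ?_
      obtain ⟨w, hw, hxw⟩ := h.exists_cyl n _ (hτB (QuotientAddGroup.mk (u x)))
      have h1 : x ∈ E w := ⟨hx, hxw⟩
      have h2 : x0 ∈ E w := (hNiff x0 hx0 hx0N w).2 ((hNiff x hx hxN w).1 h1)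
      rw [← hw]
      exact h.cyl_diam w _ hxw _ h2.2
    have e : (QuotientAddGroup.mk (u x) : G ⧸ H) = QuotientAddGroup.mk (u x0) := by
      rw [← hτu x hx, hτeq, hτu x0 hx0]
    rw [eq_comm, QuotientAddGroup.eq, neg_add_eq_sub] at e
    exact e
  obtain ⟨cs, hcs, hcd⟩ := hsep
  by_contra! hcon
  apply hBN
  have hsub : B \ N ⊆ ⋃ c ∈ cs, B ∩ u ⁻¹' (Metric.ball (u x0 + c) (ε / 2)) := by
    rintro x ⟨hx, hxN⟩
    obtain ⟨c, hc, hd⟩ := Metric.mem_closure_iff.1 (hcd (hcoset x hx hxN)) (ε / 2) (by positivity)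
    refine Set.mem_iUnion₂.2 ⟨c, hc, hx, ?_⟩
    rw [Set.mem_preimage, Metric.mem_ball, dist_eq_norm]
    rw [dist_eq_norm] at hd
    convert hd using 2
    abel
  refine measure_mono_null hsub ((measure_biUnion_null_iff hcs).2 fun c _ => ?_)
  by_contra hne
  obtain ⟨x, hx, y, hy, hxy⟩ := hcon (B ∩ u ⁻¹' (Metric.ball (u x0 + c) (ε / 2)))
    Set.inter_subset_left (h.mB.inter (mu Metric.isOpen_ball.measurableSet)) hne
  have h1 : dist (u x) (u x0 + c) < ε / 2 := hx.2
  have h2 : dist (u y) (u x0 + c) < ε / 2 := hy.2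
  have := dist_triangle_right (u x) (u y) (u x0 + c)
  linarith

theorem main [BorelSpace X] [IsProbabilityMeasure m] [NormedAddCommGroup G]
    [MeasurableSpace G] [BorelSpace G] [LocallyCompactSpace G]
    (h : IndSys m B P φ θ D0 C1) (Ω : ℕ → Set X)
    (hΩm : ∀ l, MeasurableSet (Ω l)) (hΩ : ∀ l, Ω l ⊆ P l)
    (hΩ0 : ∀ l, m (P l \ Ω l) = 0) (D : ℕ → NNReal) (hD : ∑' l, m (P l) * D l ≠ ⊤)
    (u : X → G) (mu : Measurable u)
    (hu : ∀ l, ∀ x ∈ Ω l, ∀ y ∈ Ω l,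
      dist (u x - u (φ l x)) (u y - u (φ l y)) ≤ D l * dist (φ l x) (φ l y)) :
    ∃ L : ℝ, 0 < L ∧ ∃ Z ⊆ B, m (B \ Z) = 0 ∧
      ∀ x ∈ Z, ∀ y ∈ Z, dist (u x) (u y) ≤ L * dist x y := by
  obtain ⟨M, hM⟩ := h.choose_word D hD
  obtain ⟨K, hKt, hK0, hK⟩ := h.distort_unif
  have key : ∀ n : ℕ, ∃ Z ⊆ B, m (B \ Z) ≤ 2⁻¹ ^ n ∧ ∀ x ∈ Z, ∀ y ∈ Z,
      dist (u x) (u y) ≤ (2⁻¹ : ℝ) ^ n + M * dist x y := by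
    intro n
    obtain ⟨A, hA, mA, hA0, hAu⟩ := h.small_set Ω hΩm hΩ hΩ0 D u mu hu ((2⁻¹ : ℝ) ^ n)
      (by positivity)
    have hδ0 : (2⁻¹ : ℝ≥0∞) ^ n / K ≠ 0 := by simp [ENNReal.div_eq_zero_iff, hKt]
    have hδt : (2⁻¹ : ℝ≥0∞) ^ n / K ≠ ⊤ := ENNReal.div_ne_top (by simp) hK0
    obtain ⟨w, hw, hwM⟩ := hM A hA mA hA0 _ hδ0 hδt
    obtain ⟨mg, hg0⟩ := h.good_null Ω hΩm hΩ0 w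
    set Y := A ∩ cyl B Ω φ w with hY
    have mY : MeasurableSet Y := mA.inter mg
    set Z := itr φ w '' (cyl B P φ w ∩ Y) with hZ
    have mZ : MeasurableSet Z := h.m_image w Y mY
    have hZB : Z ⊆ B := by
      rintro _ ⟨x, hx, rfl⟩; exact (h.itr_bij w).mapsTo hx.1
    refine ⟨Z, hZB, ?_, ?_⟩
    · have h1 := (hK w (B \ Z) Set.sdiff_subset (h.mB.diff mZ)).2
      have h2 : m (pull B P φ w (B \ Z)) ≤ m (cyl B P φ w \ A) := by
        calc _ ≤ m ((cyl B P φ w \ A) ∪ (cyl B P φ w \ cyl B Ω φ w)) := by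
              refine measure_mono ?_
              rintro x ⟨hx, hx2⟩
              by_cases hxA : x ∈ A
              · right
                exact ⟨hx, fun hg => hx2.2 ⟨x, ⟨hx, hxA, hg⟩, rfl⟩⟩
              · left; exact ⟨hx, hxA⟩
          _ ≤ _ := (measure_union_le _ _).trans (by rw [hg0, add_zero])
      have h4 : m (cyl B P φ w) * m (B \ Z) ≤ m (cyl B P φ w) * 2⁻¹ ^ n := by
        calc _ ≤ _ := h1
          _ ≤ K * ((2⁻¹ : ℝ≥0∞) ^ n / K * m (cyl B P φ w)) := by gcongr; exact h2.trans hw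
          _ = K * ((2⁻¹ : ℝ≥0∞) ^ n / K) * m (cyl B P φ w) := by ring
          _ = _ := by rw [ENNReal.mul_div_cancel hK0 hKt, mul_comm]
      exact (ENNReal.mul_le_mul_iff_right (h.cyl_pos w) (measure_ne_top _ _)).1 h4
    · rintro _ ⟨x, ⟨_, hxA, hxg⟩, rfl⟩ _ ⟨y, ⟨_, hyA, hyg⟩, rfl⟩
      have h1 := h.good_lip Ω hΩ D u hu w x hxg y hyg
      have h2 := hAu x hxA y hyA
      have h3 := dist_sub_sub_le (u x) (u x - u (itr φ w x)) (u y) (u y - u (itr φ w y))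
      rw [_root_.sub_sub_cancel, _root_.sub_sub_cancel] at h3
      have h5 : (cost θ D w : ℝ) * dist (itr φ w x) (itr φ w y) ≤
        M * dist (itr φ w x) (itr φ w y) := by gcongr
      linarith
  choose Z hZB hZm hZu using key
  refine ⟨M + 1, by positivity, {x | x ∈ B ∧ ∀ᶠ n in atTop, x ∈ Z n}, fun x hx => hx.1, ?_, ?_⟩
  · have hs : ∑' n, m (B \ Z n) ≠ ⊤ := by
      refine ne_top_of_le_ne_top ?_ (ENNReal.tsum_le_tsum hZm)
      rw [ENNReal.tsum_geometric, ENNReal.one_sub_inv_two, inv_inv]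
      exact ofNat_ne_top
    refine measure_mono_null ?_ (measure_setOfPred_frequently_eq_zero hs)
    rintro x ⟨hx, hx2⟩
    have : ¬ ∀ᶠ n in atTop, x ∈ Z n := fun h' => hx2 ⟨hx, h'⟩
    rw [Filter.not_eventually] at this
    exact this.mono fun n hn => ⟨hx, hn⟩
  · rintro x ⟨_, hx⟩ y ⟨_, hy⟩
    have ht : Tendsto (fun n : ℕ => (2⁻¹ : ℝ) ^ n + M * dist x y) atTop
        (nhds (0 + M * dist x y)) :=
      (_root_.tendsto_pow_atTop_nhds_zero_of_lt_one (by norm_num) (by norm_num)).add_const _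
    have : dist (u x) (u y) ≤ 0 + M * dist x y := by
      refine ge_of_tendsto ht ?_
      filter_upwards [hx, hy] with n hn1 hn2 using hZu n x hn1 y hn2
    have := dist_nonneg (x := x) (y := y)
    linarith

end IndSys

namespace YoungTower

variable [MetricSpace X] [MeasurableSpace X] {m : Measure X} {T : X → X} {R : ℕ → ℕ}
  {Δ : ℕ → ℕ → Set X} {lam C : ℝ}

theorem iter_bij (h : YoungTower m T R Δ lam C) (l k : ℕ) (hk : k < R l) :
    Set.BijOn T^[k] (Δ 0 l) (Δ k l) := by
  induction k with
  | zero => exact Set.bijOn_id _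
  | succ k ih =>
    rw [Function.iterate_succ']
    exact (h.step l k hk).1.comp (ih (by omega))

theorem iter_pres (h : YoungTower m T R Δ lam C) (l k : ℕ) (hk : k < R l) :
    ∀ N, MeasurableSet N → m (Δ 0 l ∩ T^[k] ⁻¹' N) = m (Δ k l ∩ N) := by
  induction k with
  | zero => intro N _; rfl
  | succ k ih =>
    intro N hN
    rw [Function.iterate_succ', Set.preimage_comp, ih (by omega) _ (h.measT hN)]
    rw [← (h.step l k hk).2 _ Set.inter_subset_left ((h.meas k l).inter (h.measT hN)),
      Set.image_inter_preimage, (h.step l k hk).1.image_eq]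

theorem R_eq (h : YoungTower m T R Δ lam C) (l : ℕ) : R l = (R l - 1) + 1 := by
  have := h.Rpos l; omega

theorem ret_bij (h : YoungTower m T R Δ lam C) (l : ℕ) :
    Set.BijOn T^[R l] (Δ 0 l) (⋃ l', Δ 0 l') := by
  rw [h.R_eq l, Function.iterate_succ']
  exact (h.ret l).comp (h.iter_bij l _ (by have := h.Rpos l; omega))

theorem ret_pres (h : YoungTower m T R Δ lam C) (l : ℕ) (E : Set X) (mE : MeasurableSet E) :
    m (Δ 0 l ∩ T^[R l] ⁻¹' E) = m (Δ (R l - 1) l ∩ T ⁻¹' E) := by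
  rw [← h.iter_pres l (R l - 1) (by have := h.Rpos l; omega) _ (h.measT mE), ← Set.preimage_comp,
    ← Function.iterate_succ', Nat.succ_eq_add_one, ← h.R_eq l]

theorem indSys (h : YoungTower m T R Δ lam C) : ∃ θ D0 C1 : NNReal,
    IndSys m (⋃ l, Δ 0 l) (fun l => Δ 0 l) (fun l => T^[R l]) θ D0 C1 := by
  obtain ⟨D0, hD0⟩ := Metric.isBounded_iff.1 h.bounded
  obtain ⟨g, hg, hgm, C', hC', hgC⟩ := h.distortion
  have hl0 : 0 < lam := zero_lt_one.trans h.one_lt_lam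
  refine ⟨(lam⁻¹).toNNReal, D0.toNNReal, C'.toNNReal,
    ⟨.iUnion fun l => h.meas 0 l, fun l => h.meas 0 l, fun l => h.measT.iterate _,
    fun l l' hne => h.disj 0 l 0 l' (by simpa using hne), rfl, h.ret_bij, ?_, ?_, ?_, ?_, ?_⟩⟩
  · intro l x hx y hy
    rw [Real.coe_toNNReal _ (by positivity), inv_mul_eq_div, le_div_iff₀ hl0, mul_comm]
    exact h.expand l x hx y hy
  · rw [← Real.toNNReal_one, Real.toNNReal_lt_toNNReal_iff zero_lt_one]
    exact inv_lt_one_of_one_lt₀ h.one_lt_lam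
  · intro x y
    exact (hD0 (Set.mem_univ x) (Set.mem_univ y)).trans (Real.le_coe_toNNReal _)
  · intro l r E hEB mE hEr
    rcases E.eq_empty_or_nonempty with rfl | ⟨z, hz⟩
    · refine ⟨1, one_ne_zero, one_ne_top, fun E' hE' _ => ?_⟩
      rw [Set.subset_empty_iff.1 hE']; simp
    obtain ⟨x0, hx0, rfl⟩ := (h.ret l).surjOn (hEB hz)
    set ρ : ℝ := C' * r with hρ
    have hρ0 : 0 ≤ ρ := by positivity
    have hcomp : ∀ x ∈ Δ (R l - 1) l, ∀ y ∈ Δ (R l - 1) l, T x ∈ E → T y ∈ E →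
        g x ≤ (1 + ρ) * g y := by
      intro x hx y hy hxE hyE
      have h1 := hgC l x hx y hy
      have h2 : C' * dist (T x) (T y) ≤ ρ := by
        rw [hρ]; gcongr; exact hEr _ hxE _ hyE
      have h3 := (abs_le.1 (h1.trans h2)).1
      rw [← div_le_iff₀ (hg y)]
      linarith
    have hg0 := hg x0
    refine ⟨ENNReal.ofReal (g x0 / (1 + ρ)), ?_, ofReal_ne_top, fun E' hE' mE' => ?_⟩
    · rw [ne_eq, ENNReal.ofReal_eq_zero, not_le]; positivity
    rw [h.ret_pres l E' mE']
    set s := Δ (R l - 1) l ∩ T ⁻¹' E' with hs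
    have ms : MeasurableSet s := (h.meas _ _).inter (h.measT mE')
    have hTs : T '' s = E' := by
      rw [hs, Set.image_inter_preimage, (h.ret l).image_eq]
      exact Set.inter_eq_right.2 (hE'.trans hEB)
    have hm := hgm l s Set.inter_subset_left ms
    rw [hTs] at hm
    have up : m E' ≤ ENNReal.ofReal ((1 + ρ) / g x0) * m s := by
      rw [hm, ← setLIntegral_const]
      refine setLIntegral_mono' ms fun x hx => ?_
      apply ENNReal.ofReal_le_ofReal
      rw [le_div_iff₀ hg0, inv_mul_le_iff₀ (hg x), mul_comm]
      exact hcomp x0 hx0 x hx.1 hz (hE' hx.2)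
    have lo : ENNReal.ofReal ((1 + ρ) * g x0)⁻¹ * m s ≤ m E' := by
      rw [hm, ← setLIntegral_const]
      refine setLIntegral_mono' ms fun x hx => ?_
      apply ENNReal.ofReal_le_ofReal
      have := hg x
      gcongr
      exact hcomp x hx.1 x0 hx0 (hE' hx.2) hz
    constructor
    · calc _ ≤ ENNReal.ofReal (g x0 / (1 + ρ)) * (ENNReal.ofReal ((1 + ρ) / g x0) * m s) := by
            gcongr
        _ = m s := by
            rw [← mul_assoc, ← ENNReal.ofReal_mul (by positivity)]
            rw [show g x0 / (1 + ρ) * ((1 + ρ) / g x0) = 1 by field_simp]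
            simp
    · have hc : (((1 + C'.toNNReal * r) ^ 2 : NNReal) : ℝ≥0∞) = ENNReal.ofReal ((1 + ρ) ^ 2) := by
        rw [ENNReal.ofReal, ENNReal.coe_inj]
        apply NNReal.eq
        rw [Real.coe_toNNReal _ (by positivity)]
        push_cast
        rw [Real.coe_toNNReal _ hC'.le]
      rw [hc, ← ENNReal.ofReal_mul (by positivity)]
      calc m s = ENNReal.ofReal ((1 + ρ) ^ 2 * (g x0 / (1 + ρ))) *
            (ENNReal.ofReal ((1 + ρ) * g x0)⁻¹ * m s) := by
            rw [← mul_assoc, ← ENNReal.ofReal_mul (by positivity)]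
            rw [show (1 + ρ) ^ 2 * (g x0 / (1 + ρ)) * ((1 + ρ) * g x0)⁻¹ = 1 by field_simp]
            simp
        _ ≤ _ := by gcongr
  · exact (lt_of_lt_of_le (h.pos 0) (measure_mono (Set.subset_iUnion (fun l => Δ 0 l) 0))).ne'

theorem level_eq (h : YoungTower m T R Δ lam C) (l k : ℕ) (hk : k < R l) :
    m (Δ k l) = m (Δ 0 l) := by
  simpa using (h.iter_pres l k hk Set.univ MeasurableSet.univ).symm

end YoungTower

theorem essLip_exists [MetricSpace X] [MetricSpace G] [MeasurableSpace X]
    (m : Measure X) (f : X → G) (Z : Set X) (hZ : essLip m f Z ≠ ⊤) :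
    ∃ Ω ⊆ Z, m (Z \ Ω) = 0 ∧ ∀ x ∈ Ω, ∀ y ∈ Ω,
      dist (f x) (f y) ≤ ((essLip m f Z + 1).toNNReal : ℝ) * dist x y := by
  have hlt : essLip m f Z < essLip m f Z + 1 := ENNReal.lt_add_right hZ one_ne_zero
  obtain ⟨c, ⟨Ω, h1, h2, h3⟩, hc⟩ := sInf_lt_iff.1 hlt
  refine ⟨Ω, h1, h2, ?_⟩
  have : LipschitzOnWith (essLip m f Z + 1).toNNReal f Ω := by
    intro x hx y hy
    rw [ENNReal.coe_toNNReal (by finiteness)]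
    exact (h3 x hx y hy).trans (by gcongr)
  exact fun x hx y hy => this.dist_le_mul x hx y hy

/-- Livšic regularity for Young towers: if `∑ m(Δ_{k,l}) Df(Δ_{k,l}) < ∞` and
`f = u - u ∘ T` a.e., then `u` has a version which is Lipschitz on the base `Δ₀`. -/
theorem young_tower_coboundary_regularity
    [MetricSpace X] [MeasurableSpace X] [BorelSpace X]
    [MetricSpace G] [AddCommGroup G] [MeasurableSpace G] [BorelSpace G]
    [LocallyCompactSpace G]
    (hinv : ∀ g x y : G, dist (g + x) (g + y) = dist x y)
    (m : Measure X) [IsProbabilityMeasure m]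
    (T : X → X) (R : ℕ → ℕ) (Δ : ℕ → ℕ → Set X) (lam C : ℝ)
    (hYT : YoungTower m T R Δ lam C)
    (f u : X → G) (hu : Measurable u)
    (hf : (∑' l : ℕ, ∑ k ∈ Finset.range (R l), m (Δ k l) * essLip m f (Δ k l)) ≠ ⊤)
    (hcob : ∀ᵐ x ∂m, f x = u x - u (T x)) :
    ∃ C' : ℝ, 0 < C' ∧ ∃ Ω : Set X, Ω ⊆ (⋃ l, Δ 0 l) ∧ m ((⋃ l, Δ 0 l) \ Ω) = 0 ∧
      ∀ x ∈ Ω, ∀ y ∈ Ω, dist (u x) (u y) ≤ C' * dist x y := by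
  classical
  letI : Norm G := ⟨fun x => dist 0 x⟩
  letI : NormedAddCommGroup G :=
    NormedAddCommGroup.ofAddDist (fun _ => rfl) (fun x y z => (hinv z x y).ge)
  obtain ⟨θ, D0, C1, hI⟩ := hYT.indSys
  have hfin : ∀ l k, k < R l → essLip m f (Δ k l) ≠ ⊤ := by
    intro l k hk htop
    have h1 := ENNReal.ne_top_of_tsum_ne_top hf l
    have h2 := (ENNReal.sum_ne_top.1 h1) k (Finset.mem_range.2 hk)
    rw [htop, hYT.level_eq l k hk, ENNReal.mul_top (hYT.pos l).ne'] at h2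
    exact h2 rfl
  have hex : ∀ l k, ∃ Ω : Set X, k < R l → Ω ⊆ Δ k l ∧ m (Δ k l \ Ω) = 0 ∧ ∀ x ∈ Ω, ∀ y ∈ Ω,
      dist (f x) (f y) ≤ ((essLip m f (Δ k l) + 1).toNNReal : ℝ) * dist x y := by
    intro l k
    by_cases hk : k < R l
    · obtain ⟨Ω, h1, h2, h3⟩ := essLip_exists m f (Δ k l) (hfin l k hk)
      exact ⟨Ω, fun _ => ⟨h1, h2, h3⟩⟩
    · exact ⟨∅, fun h => absurd h hk⟩
  choose Ω' hΩ' using hex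
  set N0 : Set X := {x | ¬ f x = u x - u (T x)} ∪
    ⋃ l, ⋃ k, if k < R l then Δ k l \ Ω' l k else ∅ with hN0
  have hN0m : m N0 = 0 := by
    refine measure_union_null (ae_iff.1 hcob) (measure_iUnion_null fun l =>
      measure_iUnion_null fun k => ?_)
    split_ifs with hk
    · exact (hΩ' l k hk).2.1
    · simp
  set N := toMeasurable m N0 with hN
  have mN : MeasurableSet N := measurableSet_toMeasurable _ _
  have hNm : m N = 0 := by rw [hN, measure_toMeasurable, hN0m]
  have hNcob : ∀ x, x ∉ N → f x = u x - u (T x) := by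
    intro x hx
    by_contra hcon
    exact hx (subset_toMeasurable _ _ (Or.inl hcon))
  have hNΩ : ∀ l k, k < R l → ∀ x ∈ Δ k l, x ∉ N → x ∈ Ω' l k := by
    intro l k hk x hx hxN
    by_contra hcon
    refine hxN (subset_toMeasurable _ _ (Or.inr (Set.mem_iUnion₂.2 ⟨l, k, ?_⟩)))
    rw [if_pos hk]; exact ⟨hx, hcon⟩
  set Ω : ℕ → Set X := fun l => Δ 0 l \ ⋃ k ∈ Finset.range (R l), T^[k] ⁻¹' N with hΩ
  set c : ℕ → ℕ → NNReal := fun l k => (essLip m f (Δ k l) + 1).toNNReal with hc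
  set D : ℕ → NNReal := fun l => C.toNNReal * ∑ k ∈ Finset.range (R l), c l k with hD
  refine hI.main Ω ?_ (fun l => Set.sdiff_subset) ?_ D ?_ u hu ?_
  · exact fun l => (hYT.meas 0 l).diff
      (Finset.measurableSet_biUnion _ fun k _ => hYT.measT.iterate k mN)
  · intro l
    have : Δ 0 l \ Ω l ⊆ ⋃ k ∈ Finset.range (R l), (Δ 0 l ∩ T^[k] ⁻¹' N) := by
      rintro x ⟨hx, hx2⟩
      have : x ∈ ⋃ k ∈ Finset.range (R l), T^[k] ⁻¹' N := by
        by_contra hcon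
        exact hx2 ⟨hx, hcon⟩
      obtain ⟨k, hk, hxk⟩ := Set.mem_iUnion₂.1 this
      exact Set.mem_iUnion₂.2 ⟨k, hk, hx, hxk⟩
    refine measure_mono_null this ?_
    refine (measure_biUnion_null_iff (Finset.countable_toSet _)).2 fun k hk => ?_
    rw [hYT.iter_pres l k (Finset.mem_range.1 hk) N mN]
    exact measure_mono_null Set.inter_subset_right hNm
  · have hterm : ∀ l, m (Δ 0 l) * (D l : ℝ≥0∞) = C.toNNReal *
        (∑ k ∈ Finset.range (R l), m (Δ k l) * essLip m f (Δ k l) +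
          ∑ k ∈ Finset.range (R l), m (Δ k l)) := by
      intro l
      rw [← Finset.sum_add_distrib, hD]
      push_cast
      rw [mul_left_comm, Finset.mul_sum]
      congr 1
      refine Finset.sum_congr rfl fun k hk => ?_
      have hk' := Finset.mem_range.1 hk
      have := hfin l k hk'
      rw [hYT.level_eq l k hk', hc, ENNReal.coe_toNNReal (by finiteness), mul_add, mul_one]
    rw [tsum_congr hterm, ENNReal.tsum_mul_left, ENNReal.tsum_add]
    refine mul_ne_top coe_ne_top (ENNReal.add_ne_top.2 ⟨hf, ?_⟩)
    refine ne_top_of_le_ne_top one_ne_top ?_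
    calc ∑' l, ∑ k ∈ Finset.range (R l), m (Δ k l) ≤ ∑' l, ∑' k, m (Δ k l) :=
          ENNReal.tsum_le_tsum fun l => ENNReal.sum_le_tsum _
      _ = ∑' p : ℕ × ℕ, m (Δ p.2 p.1) :=
          (ENNReal.tsum_prod' (f := fun p : ℕ × ℕ => m (Δ p.2 p.1))).symm
      _ = m (⋃ p : ℕ × ℕ, Δ p.2 p.1) := by
          refine (measure_iUnion ?_ fun p => hYT.meas _ _).symm
          intro p q hpq
          refine hYT.disj _ _ _ _ fun e => hpq ?_
          simp only [Prod.mk.injEq] at e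
          exact Prod.ext e.2 e.1
      _ ≤ 1 := prob_le_one
  · have hΩN : ∀ l, ∀ x ∈ Ω l, ∀ k < R l, T^[k] x ∉ N := fun l x hx k hk hcon =>
      hx.2 (Set.mem_iUnion₂.2 ⟨k, Finset.mem_range.2 hk, hcon⟩)
    have htel : ∀ l, ∀ x ∈ Ω l, u x - u (T^[R l] x) = ∑ k ∈ Finset.range (R l), f (T^[k] x) := by
      intro l x hx
      rw [Finset.sum_congr rfl fun k hk => hNcob _ (hΩN l x hx k (Finset.mem_range.1 hk))]
      have := Finset.sum_range_sub' (fun k => u (T^[k] x)) (R l)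
      simp only [Function.iterate_succ_apply', Function.iterate_zero, id] at this
      exact this.symm
    intro l x hx y hy
    rw [htel l x hx, htel l y hy]
    refine (dist_sum_sum_le _ _ _).trans ?_
    calc ∑ k ∈ Finset.range (R l), dist (f (T^[k] x)) (f (T^[k] y))
        ≤ ∑ k ∈ Finset.range (R l), (c l k : ℝ) * (C * dist (T^[R l] x) (T^[R l] y)) := by
          refine Finset.sum_le_sum fun k hk => ?_
          have hk' := Finset.mem_range.1 hk
          have hx' := (hYT.iter_bij l k hk').mapsTo hx.1
          have hy' := (hYT.iter_bij l k hk').mapsTo hy.1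
          refine ((hΩ' l k hk').2.2 _ (hNΩ l k hk' _ hx' (hΩN l x hx k hk')) _
            (hNΩ l k hk' _ hy' (hΩN l y hy k hk'))).trans ?_
          gcongr
          have := hYT.back l k hk' _ hx' _ hy'
          rwa [← Function.iterate_add_apply, ← Function.iterate_add_apply,
            Nat.sub_add_cancel hk'.le] at this
      _ = _ := by
          rw [← Finset.sum_mul, hD]
          push_cast
          rw [Real.coe_toNNReal _ hYT.Cpos.le]
          ring
end

section
/- Let T be the Liverani–Saussol–Vaienti intermittent map on [0,1] with parameter α∈(0,1): T(x)=x(1+2^α x^α) for x≤1/2 and T(x)=2x-1 for x>1/2. Let f:[0,1]→G be Hölder with exponent γ>0 on each of the intervals [0,1/2] and (1/2,1]. If u:[0,1]→G is measurable and f = u - u∘T Lebesgue almost everywhere, then there exists ũ, equal to u almost everywhere, Hölder continuous with exponent γ on [0,1], such that f = ũ - ũ∘T everywhere. -/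
open MeasureTheory Set

/-- The Liverani–Saussol–Vaienti intermittent map with parameter `a ∈ (0,1)`:
`T x = x (1 + 2^a x^a)` for `x ≤ 1/2` and `T x = 2x - 1` for `x > 1/2`. -/
noncomputable def lsv (a : ℝ) (x : ℝ) : ℝ :=
  if x ≤ 1/2 then x * (1 + (2:ℝ) ^ a * x ^ a) else 2 * x - 1

open MeasureTheory Set
namespace LSV

/-- left branch -/
noncomputable def TL (a x : ℝ) : ℝ := x * (1 + (2:ℝ) ^ a * x ^ a)

/-- inverse of the left branch -/
noncomputable def h1 (a : ℝ) : ℝ → ℝ := Function.invFunOn (TL a) (Icc 0 (1/2))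

/-- inverse branch along the itinerary of `z` -/
noncomputable def H (a z y : ℝ) : ℝ := if z ≤ 1/2 then h1 a y else (y + 1) / 2

section
variable {a : ℝ}

lemma TL_cont (ha : 0 < a) : Continuous (TL a) := by
  unfold TL
  exact continuous_id.mul (continuous_const.add (continuous_const.mul
    (Real.continuous_rpow_const ha.le)))

lemma TL_slope (ha : 0 < a) {p q : ℝ} (hp : 0 ≤ p) (hpq : p < q) :
    ∃ ξ ∈ Ioo p q, TL a q - TL a p = (1 + (1 + a) * (2:ℝ) ^ a * ξ ^ a) * (q - p) := by
  obtain ⟨ξ, hξ, h⟩ := exists_hasDerivAt_eq_slope (TL a)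
    (fun x => 1 + (1 + a) * (2:ℝ) ^ a * x ^ a) hpq (TL_cont ha).continuousOn (by
      intro x hx
      have hx0 : 0 < x := lt_of_le_of_lt hp hx.1
      have h1 := (hasDerivAt_id x).mul (((Real.hasDerivAt_rpow_const (x := x) (p := a)
        (Or.inl hx0.ne')).const_mul ((2:ℝ)^a)).const_add 1)
      have : (1 + (1 + a) * (2:ℝ) ^ a * x ^ a)
          = 1 * (1 + 2 ^ a * x ^ a) + id x * (2 ^ a * (a * x ^ (a - 1))) := by
        have : x ^ a = x * x ^ (a-1) := by
          rw [Real.rpow_sub_one hx0.ne']; field_simp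
        rw [this]; simp; ring
      rw [this]
      exact h1)
  refine ⟨ξ, hξ, ?_⟩
  have : q - p ≠ 0 := by linarith
  rw [h]; field_simp

lemma two_rpow_mul_half (a : ℝ) : (2:ℝ)^a * (1/2:ℝ)^a = 1 := by
  rw [← Real.mul_rpow (by norm_num) (by norm_num)]; norm_num

lemma TL_expand (ha : 0 < a) {s p q : ℝ} (hs : 0 ≤ s) (hp : s ≤ p) (hpq : p ≤ q) :
    (1 + (2:ℝ)^a * s^a) * (q - p) ≤ TL a q - TL a p := by
  rcases hpq.eq_or_lt with rfl | hpq
  · simp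
  obtain ⟨ξ, hξ, h⟩ := TL_slope ha (hs.trans hp) hpq
  rw [h]
  have h1 : s^a ≤ ξ^a := Real.rpow_le_rpow hs (by linarith [hξ.1]) ha.le
  have h2 : 0 < (2:ℝ)^a := by positivity
  have h3 : 0 ≤ s^a := by positivity
  have : (2:ℝ)^a * s^a ≤ (1 + a) * 2^a * ξ^a := by
    have : 0 ≤ (2:ℝ)^a * ξ^a * a := by
      have : 0 ≤ ξ ^ a := h3.trans h1
      positivity
    nlinarith
  nlinarith

lemma TL_expand1 (ha : 0 < a) {p q : ℝ} (hp : 0 ≤ p) (hpq : p ≤ q) :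
    (q - p) ≤ TL a q - TL a p := by
  have := TL_expand ha le_rfl hp hpq
  rw [Real.zero_rpow ha.ne'] at this
  linarith

lemma TL_upper (ha : 0 < a) (ha1 : a < 1) {p q : ℝ} (hp : 0 ≤ p) (hpq : p ≤ q) (hq : q ≤ 1/2) :
    TL a q - TL a p ≤ 3 * (q - p) := by
  rcases hpq.eq_or_lt with rfl | hpq
  · simp
  obtain ⟨ξ, hξ, h⟩ := TL_slope ha hp hpq
  rw [h]
  have h1 : ξ^a ≤ (1/2)^a := Real.rpow_le_rpow (by linarith [hξ.1]) (by linarith [hξ.2]) ha.le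
  have h2 : 0 < (2:ℝ)^a := by positivity
  have h4 := two_rpow_mul_half a
  have h5 : (2:ℝ)^a * ξ^a ≤ 1 := by nlinarith
  have h6 : (1+a) * (2:ℝ)^a * ξ^a ≤ 2 := by nlinarith
  nlinarith

lemma TL_dist (ha : 0 < a) (ha1 : a < 1) {l r p q p' q' : ℝ} (hl : 0 ≤ l)
    (h1 : l ≤ p) (h2 : p < q) (h3 : q ≤ r) (h1' : l ≤ p') (h2' : p' < q') (h3' : q' ≤ r) :
    (TL a q - TL a p) * (q' - p') ≤ Real.exp (4 * (r - l)^a) * ((TL a q' - TL a p') * (q - p)) := by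
  obtain ⟨ξ, hξ, h⟩ := TL_slope ha (hl.trans h1) h2
  obtain ⟨η, hη, h'⟩ := TL_slope ha (hl.trans h1') h2'
  rw [h, h']
  have hηl : l ≤ η := by linarith [hη.1]
  have hξl : l ≤ ξ := by linarith [hξ.1]
  have hηr : η ≤ r := by linarith [hη.2]
  have hξr : ξ ≤ r := by linarith [hξ.2]
  have k1 : ξ^a ≤ η^a + (r-l)^a := by
    have : ξ^a ≤ (η + (r - l))^a := Real.rpow_le_rpow (by linarith) (by linarith) ha.le
    exact this.trans (Real.rpow_add_le_add_rpow (by linarith) (by linarith) ha.le ha1.le)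
  have k2 : (2:ℝ)^a ≤ 2 := by
    calc (2:ℝ)^a ≤ 2^(1:ℝ) := Real.rpow_le_rpow_of_exponent_le (by norm_num) ha1.le
      _ = 2 := by norm_num
  have k3 : 0 < (2:ℝ)^a := by positivity
  have k4 : 0 ≤ (r-l)^a := Real.rpow_nonneg (by linarith) _
  have k5 : 0 ≤ η^a := Real.rpow_nonneg (by linarith) _
  have k6 : (1+a) * (2:ℝ)^a ≤ 4 := by nlinarith
  have k7 : 0 < (1+a) * (2:ℝ)^a := by positivity
  set c := (1+a) * (2:ℝ)^a
  have k8 : 1 + c * ξ^a ≤ Real.exp (4 * (r-l)^a) * (1 + c * η^a) := by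
    have e1 := Real.add_one_le_exp (4 * (r-l)^a)
    have e2 : 0 ≤ c * η^a := by positivity
    calc 1 + c * ξ^a ≤ 1 + c * (η^a + (r-l)^a) := by gcongr
      _ ≤ (4 * (r-l)^a + 1) * (1 + c * η^a) := by nlinarith [mul_nonneg k4 e2]
      _ ≤ _ := by gcongr
  have : 0 ≤ (q-p) * (q'-p') := mul_nonneg (by linarith) (by linarith)
  calc _ = (1 + c * ξ^a) * ((q-p) * (q'-p')) := by ring
    _ ≤ (Real.exp (4 * (r-l)^a) * (1 + c * η^a)) * ((q-p) * (q'-p')) := by gcongr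
    _ = _ := by ring

lemma TL_zero : TL a 0 = 0 := by simp [TL]
lemma TL_half : TL a (1/2) = 1 := by unfold TL; rw [two_rpow_mul_half]; norm_num

lemma TL_convex (ha : 0 < a) : ConvexOn ℝ (Ici 0) (TL a) := by
  have h := (convexOn_id (convex_Ici (0:ℝ))).add
    ((convexOn_rpow (p := 1 + a) (by linarith)).smul (c := (2:ℝ)^a) (by positivity))
  refine h.congr ?_
  intro x hx
  have hx : (0:ℝ) ≤ x := hx
  simp only [TL, Pi.add_apply, id, smul_eq_mul]
  rw [Real.rpow_add_of_nonneg hx (by norm_num) ha.le, Real.rpow_one]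
  ring

lemma h1_spec (ha : 0 < a) {y : ℝ} (hy : y ∈ Icc (0:ℝ) 1) :
    h1 a y ∈ Icc (0:ℝ) (1/2) ∧ TL a (h1 a y) = y := by
  have : ∃ x ∈ Icc (0:ℝ) (1/2), TL a x = y := by
    have := intermediate_value_Icc (show (0:ℝ) ≤ 1/2 by norm_num) (TL_cont ha).continuousOn
    rw [TL_zero, TL_half] at this
    exact this hy
  exact ⟨Function.invFunOn_mem this, Function.invFunOn_eq this⟩

lemma TL_strictMono (ha : 0 < a) {p q : ℝ} (hp : 0 ≤ p) (hq : 0 ≤ q) : TL a p ≤ TL a q ↔ p ≤ q := by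
  constructor
  · intro h
    by_contra hh
    push Not at hh
    linarith [TL_expand1 ha hq hh.le]
  · intro h; linarith [TL_expand1 ha hp h]

lemma lsv_le {x : ℝ} (h : x ≤ 1/2) : lsv a x = TL a x := by simp only [lsv, TL, if_pos h]
lemma lsv_gt {x : ℝ} (h : 1/2 < x) : lsv a x = 2 * x - 1 := by
  simp only [lsv, if_neg (not_le.2 h)]

lemma lsv_mem (ha : 0 < a) {x : ℝ} (hx : x ∈ Icc (0:ℝ) 1) : lsv a x ∈ Icc (0:ℝ) 1 := by
  by_cases h : x ≤ 1/2
  · rw [lsv_le h]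
    have h0 := (TL_strictMono ha le_rfl hx.1).2 hx.1
    have h1 := (TL_strictMono ha hx.1 (by norm_num)).2 h
    rw [TL_zero] at h0; rw [TL_half] at h1
    exact ⟨h0, h1⟩
  · push Not at h
    rw [lsv_gt h]; constructor <;> linarith [hx.2]

lemma h1_TL (ha : 0 < a) {x : ℝ} (hx : x ∈ Icc (0:ℝ) (1/2)) : h1 a (TL a x) = x := by
  have hm : TL a x ∈ Icc (0:ℝ) 1 := by
    have := lsv_mem ha (x := x) ⟨hx.1, by linarith [hx.2]⟩
    rwa [lsv_le hx.2] at this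
  have := h1_spec ha hm
  exact le_antisymm ((TL_strictMono ha this.1.1 hx.1).1 this.2.le)
    ((TL_strictMono ha hx.1 this.1.1).1 this.2.ge)

lemma h1_concave (ha : 0 < a) : ConcaveOn ℝ (Icc 0 1) (h1 a) := by
  refine ⟨convex_Icc _ _, ?_⟩
  intro x hx y hy s t hs ht hst
  have hz := (convex_Icc (0:ℝ) 1) hx hy hs ht hst
  have e1 := h1_spec ha hx
  have e2 := h1_spec ha hy
  have e3 := h1_spec ha hz
  have h0 : 0 ≤ s • h1 a x + t • h1 a y := by
    have := e1.1.1; have := e2.1.1; simp only [smul_eq_mul]; positivity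
  rw [← TL_strictMono ha h0 e3.1.1, e3.2]
  have := (TL_convex ha).2 (x := h1 a x) (y := h1 a y) e1.1.1 e2.1.1 hs ht hst
  rwa [e1.2, e2.2] at this

/-! inverse branch facts -/

lemma H_mem (ha : 0 < a) (z : ℝ) {y : ℝ} (hy : y ∈ Icc (0:ℝ) 1) : H a z y ∈ Icc (0:ℝ) 1 := by
  unfold H
  split_ifs
  · have := (h1_spec ha hy).1
    exact ⟨this.1, by linarith [this.2]⟩
  · constructor <;> linarith [hy.1, hy.2]

lemma H_lsv (ha : 0 < a) {z : ℝ} (hz : z ∈ Icc (0:ℝ) 1) : H a z (lsv a z) = z := by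
  unfold H
  split_ifs with h
  · rw [lsv_le h, h1_TL ha ⟨hz.1, h⟩]
  · push Not at h
    rw [lsv_gt h]; ring

lemma H_side (ha : 0 < a) (z : ℝ) {y : ℝ} (hy : y ∈ Ioc (0:ℝ) 1) : H a z y ≤ 1/2 ↔ z ≤ 1/2 := by
  unfold H
  split_ifs with h
  · have := (h1_spec ha ⟨hy.1.le, hy.2⟩).1
    simp only [h, this.2]
  · simp only [h, iff_false]; push Not; linarith [hy.1]

lemma lsv_H (ha : 0 < a) (z : ℝ) {y : ℝ} (hy : y ∈ Ioc (0:ℝ) 1) : lsv a (H a z y) = y := by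
  by_cases h : z ≤ 1/2
  · rw [lsv_le ((H_side ha z hy).2 h)]
    simp only [H, if_pos h]
    exact (h1_spec ha ⟨hy.1.le, hy.2⟩).2
  · have : ¬ H a z y ≤ 1/2 := fun hh => h ((H_side ha z hy).1 hh)
    push Not at this
    rw [lsv_gt this]; simp only [H, if_neg h]; ring

lemma H_expand (ha : 0 < a) (ha1 : a < 1) (z : ℝ) {x y s : ℝ} (hx : 0 ≤ x) (hxy : x ≤ y)
    (hy : y ≤ 1) (hs : 0 ≤ s) (hs2 : s ≤ 1/2) (hsx : s ≤ H a z x) :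
    (1 + (2:ℝ)^a * s^a) * (H a z y - H a z x) ≤ y - x := by
  unfold H at *
  split_ifs at * with h
  · have e1 := h1_spec ha (y := x) ⟨hx, by linarith⟩
    have e2 := h1_spec ha (y := y) ⟨by linarith, hy⟩
    have := (TL_strictMono ha e1.1.1 e2.1.1).1 (by rw [e1.2, e2.2]; exact hxy)
    have := TL_expand ha hs hsx this
    rwa [e1.2, e2.2] at this
  · have h1 : s^a ≤ (1/2)^a := Real.rpow_le_rpow hs hs2 ha.le
    have h2 : 0 < (2:ℝ)^a := by positivity
    have h4 := two_rpow_mul_half a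
    have h5 : (2:ℝ)^a * s^a ≤ 1 := by nlinarith
    nlinarith

lemma H_contract (ha : 0 < a) (ha1 : a < 1) (z : ℝ) {x y : ℝ} (hx : 0 ≤ x) (hxy : x ≤ y)
    (hy : y ≤ 1) : H a z y - H a z x ≤ y - x := by
  have := H_expand ha ha1 z hx hxy hy le_rfl (by norm_num) (H_mem ha z ⟨hx, by linarith⟩).1
  rw [Real.zero_rpow ha.ne'] at this
  linarith

lemma H_lower (ha : 0 < a) (ha1 : a < 1) (z : ℝ) {x y : ℝ} (hx : 0 ≤ x) (hxy : x ≤ y)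
    (hy : y ≤ 1) : y - x ≤ 3 * (H a z y - H a z x) := by
  unfold H at *
  split_ifs at * with h
  · have e1 := h1_spec ha (y := x) ⟨hx, by linarith⟩
    have e2 := h1_spec ha (y := y) ⟨by linarith, hy⟩
    have := (TL_strictMono ha e1.1.1 e2.1.1).1 (by rw [e1.2, e2.2]; exact hxy)
    have := TL_upper ha ha1 e1.1.1 this e2.1.2
    rwa [e1.2, e2.2] at this
  · linarith

lemma H_mono (ha : 0 < a) (ha1 : a < 1) (z : ℝ) {x y : ℝ} (hx : 0 ≤ x) (hxy : x ≤ y)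
    (hy : y ≤ 1) : H a z x ≤ H a z y := by
  linarith [H_lower ha ha1 z hx hxy hy]

lemma H_lt (ha : 0 < a) (ha1 : a < 1) (z : ℝ) {x y : ℝ} (hx : 0 ≤ x) (hxy : x < y)
    (hy : y ≤ 1) : H a z x < H a z y := by
  linarith [H_lower ha ha1 z hx hxy.le hy]

/-- distortion of an inverse branch -/
lemma H_dist (ha : 0 < a) (ha1 : a < 1) (z : ℝ) {l r p q p' q' : ℝ} (hl : 0 ≤ l) (hr : r ≤ 1)
    (h1 : l ≤ p) (h2 : p < q) (h3 : q ≤ r) (h1' : l ≤ p') (h2' : p' < q') (h3' : q' ≤ r) :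
    (H a z q - H a z p) * (q' - p') ≤
      Real.exp (4 * (H a z r - H a z l)^a) * ((H a z q' - H a z p') * (q - p)) := by
  have g1 := H_mono ha ha1 z hl h1 (by linarith)
  have g2 := H_lt ha ha1 z (by linarith) h2 (by linarith)
  have g3 := H_mono ha ha1 z (x := q) (by linarith) h3 (by linarith)
  have g1' := H_mono ha ha1 z hl h1' (by linarith)
  have g2' := H_lt ha ha1 z (by linarith) h2' (by linarith)
  have g3' := H_mono ha ha1 z (x := q') (by linarith) h3' (by linarith)
  have g0 := (H_mem ha z (y := l) ⟨hl, by linarith⟩).1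
  by_cases h : z ≤ 1/2
  · have := TL_dist ha ha1 g0 g1' g2' g3' g1 g2 g3
    have e : ∀ y ∈ Icc (0:ℝ) 1, TL a (H a z y) = y := by
      intro y hy; simp only [H, if_pos h]; exact (h1_spec ha hy).2
    rw [e q ⟨by linarith, by linarith⟩, e p ⟨by linarith, by linarith⟩,
      e q' ⟨by linarith, by linarith⟩, e p' ⟨by linarith, by linarith⟩] at this
    linarith
  · have : 1 ≤ Real.exp (4 * (H a z r - H a z l)^a) := by
      apply Real.one_le_exp
      have := Real.rpow_nonneg (x := H a z r - H a z l) (by linarith) a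
      linarith
    have e : (H a z q - H a z p) * (q' - p') = ((H a z q' - H a z p') * (q - p)) := by
      simp only [H, if_neg h]; ring
    rw [e]
    have : 0 ≤ ((H a z q' - H a z p') * (q - p)) := mul_nonneg (by linarith) (by linarith)
    nlinarith

end
end LSV

open MeasureTheory Set
namespace LSV

/-- inverse branch of `T^n` along the itinerary of `z` -/
noncomputable def g (a : ℝ) : ℕ → ℝ → ℝ → ℝ
  | 0, _, y => y
  | n+1, z, y => H a z (g a n (lsv a z) y)

/-- length of the cylinder of rank `n` around `z` -/
noncomputable def ell (a : ℝ) (n : ℕ) (z : ℝ) : ℝ := g a n z 1 - g a n z 0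

/-- sum of powers of lengths of the iterates of a cylinder -/
noncomputable def D (a κ : ℝ) : ℕ → ℝ → ℝ
  | 0, _ => 0
  | n+1, z => ell a (n+1) z ^ κ + D a κ n (lsv a z)

/-- number of visits to `(s,1]` -/
noncomputable def V (a s : ℝ) (n : ℕ) (z : ℝ) : ℕ :=
  ∑ j ∈ Finset.range n, if s < (lsv a)^[j] z then 1 else 0

/-- the preimages of `1` in the left branch -/
noncomputable def xs (a : ℝ) : ℕ → ℝ
  | 0 => 1
  | m+1 => h1 a (xs a m)

section
variable {a : ℝ}

lemma g_mem (ha : 0 < a) (n : ℕ) : ∀ (z : ℝ) {y : ℝ}, y ∈ Icc (0:ℝ) 1 → g a n z y ∈ Icc (0:ℝ) 1 := by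
  induction n with
  | zero => intro z y hy; exact hy
  | succ n ih => intro z y hy; exact H_mem ha z (ih _ hy)

lemma g_lt (ha : 0 < a) (ha1 : a < 1) (n : ℕ) : ∀ (z : ℝ) {x y : ℝ}, 0 ≤ x → x < y → y ≤ 1 →
    g a n z x < g a n z y := by
  induction n with
  | zero => intro z x y h1 h2 h3; exact h2
  | succ n ih =>
    intro z x y h1 h2 h3
    exact H_lt ha ha1 z (g_mem ha n _ ⟨h1, by linarith⟩).1 (ih _ h1 h2 h3)
      (g_mem ha n _ ⟨by linarith, h3⟩).2

lemma g_le (ha : 0 < a) (ha1 : a < 1) (n : ℕ) (z : ℝ) {x y : ℝ} (h1 : 0 ≤ x) (h2 : x ≤ y)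
    (h3 : y ≤ 1) : g a n z x ≤ g a n z y := by
  rcases h2.eq_or_lt with rfl | h
  · exact le_rfl
  · exact (g_lt ha ha1 n z h1 h h3).le

lemma g_mem' (ha : 0 < a) (ha1 : a < 1) (n : ℕ) (z : ℝ) {y : ℝ} (hy : y ∈ Ioc (0:ℝ) 1) :
    g a n z y ∈ Ioc (0:ℝ) 1 :=
  ⟨lt_of_le_of_lt (g_mem ha n z (y := 0) (by simp)).1 (g_lt ha ha1 n z le_rfl hy.1 hy.2),
    (g_mem ha n z ⟨hy.1.le, hy.2⟩).2⟩

lemma g_self (ha : 0 < a) (n : ℕ) : ∀ {z : ℝ}, z ∈ Icc (0:ℝ) 1 → g a n z ((lsv a)^[n] z) = z := by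
  induction n with
  | zero => intro z hz; rfl
  | succ n ih =>
    intro z hz
    simp only [g, Function.iterate_succ, Function.comp]
    rw [ih (lsv_mem ha hz), H_lsv ha hz]

lemma iter_mem (ha : 0 < a) (n : ℕ) {z : ℝ} (hz : z ∈ Icc (0:ℝ) 1) :
    (lsv a)^[n] z ∈ Icc (0:ℝ) 1 := by
  induction n with
  | zero => exact hz
  | succ n ih => rw [Function.iterate_succ_apply']; exact lsv_mem ha ih

lemma ell_pos (ha : 0 < a) (ha1 : a < 1) (n : ℕ) (z : ℝ) : 0 < ell a n z :=
  sub_pos.2 (g_lt ha ha1 n z le_rfl one_pos le_rfl)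

lemma ell_le_one (ha : 0 < a) (n : ℕ) (z : ℝ) : ell a n z ≤ 1 := by
  have h1 := (g_mem ha n z (y := 0) (by simp)).1
  have h2 := (g_mem ha n z (y := 1) (by simp)).2
  unfold ell; linarith

lemma D_nonneg (ha : 0 < a) (ha1 : a < 1) (κ : ℝ) (n : ℕ) : ∀ z, 0 ≤ D a κ n z := by
  induction n with
  | zero => intro z; exact le_rfl
  | succ n ih =>
    intro z
    have := Real.rpow_nonneg (ell_pos ha ha1 (n+1) z).le κ
    have := ih (lsv a z)
    simp only [D]; linarith

lemma g_distort (ha : 0 < a) (ha1 : a < 1) {κ : ℝ} (hκ : κ ≤ a) (n : ℕ) :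
    ∀ (z : ℝ) {x y : ℝ}, 0 ≤ x → x < y → y ≤ 1 →
    g a n z y - g a n z x ≤ Real.exp (4 * D a κ n z) * (ell a n z * (y - x)) ∧
    ell a n z * (y - x) ≤ Real.exp (4 * D a κ n z) * (g a n z y - g a n z x) := by
  induction n with
  | zero => intro z x y h1 h2 h3; simp [g, ell, D]
  | succ n ih =>
    intro z x y hx hxy hy
    obtain ⟨i1, i2⟩ := ih (lsv a z) hx hxy hy
    have k0 := (g_mem ha n (lsv a z) (y := 0) (by simp)).1
    have k1 := (g_mem ha n (lsv a z) (y := 1) (by simp)).2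
    have k2 := g_le ha ha1 n (lsv a z) le_rfl hx (by linarith)
    have k3 := g_lt ha ha1 n (lsv a z) hx hxy hy
    have k4 := g_le ha ha1 n (lsv a z) (by linarith) hy le_rfl
    have k5 := g_lt ha ha1 n (lsv a z) (le_refl 0) one_pos le_rfl
    have d1 := H_dist ha ha1 z k0 k1 k2 k3 k4 le_rfl k5 le_rfl
    have d2 := H_dist ha ha1 z k0 k1 le_rfl k5 le_rfl k2 k3 k4
    have hL : ell a n (lsv a z) = g a n (lsv a z) 1 - g a n (lsv a z) 0 := rfl
    have hl : ell a (n+1) z = H a z (g a n (lsv a z) 1) - H a z (g a n (lsv a z) 0) := rfl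
    rw [← hL, ← hl] at d1 d2
    have hlp := ell_pos ha ha1 (n+1) z
    have hLp := ell_pos ha ha1 n (lsv a z)
    have hle := ell_le_one ha (n+1) z
    have hpow : ell a (n+1) z ^ a ≤ ell a (n+1) z ^ κ :=
      Real.rpow_le_rpow_of_exponent_ge hlp hle hκ
    have he : Real.exp (4 * ell a (n+1) z ^ a) ≤ Real.exp (4 * ell a (n+1) z ^ κ) :=
      Real.exp_le_exp.2 (by linarith)
    have hD : Real.exp (4 * D a κ (n+1) z)
        = Real.exp (4 * ell a (n+1) z ^ κ) * Real.exp (4 * D a κ n (lsv a z)) := by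
      rw [← Real.exp_add, D]; ring_nf
    rw [hD]
    change (H a z (g a n (lsv a z) y) - H a z (g a n (lsv a z) x) ≤ _) ∧ 
      (_ ≤ _ * (H a z (g a n (lsv a z) y) - H a z (g a n (lsv a z) x)))
    have k3' := H_lt ha ha1 z (by linarith) k3 (by linarith)
    set P := H a z (g a n (lsv a z) y) - H a z (g a n (lsv a z) x)
    have hP : 0 < P := by simp only [P]; linarith
    set X := g a n (lsv a z) y - g a n (lsv a z) x
    have hX : 0 < X := by simp only [X]; linarith
    set L := ell a n (lsv a z)
    set l := ell a (n+1) z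
    set E := Real.exp (4 * l ^ κ)
    set E' := Real.exp (4 * D a κ n (lsv a z))
    have hE : 0 < E := Real.exp_pos _
    have hE' : 0 < E' := Real.exp_pos _
    constructor
    · refine le_of_mul_le_mul_right ?_ hLp
      calc P * L ≤ Real.exp (4 * l ^ a) * (l * X) := d1
        _ ≤ E * (l * (E' * (L * (y - x)))) := by gcongr
        _ = _ := by ring
    · refine le_of_mul_le_mul_right ?_ hLp
      calc l * (y - x) * L = l * (L * (y - x)) := by ring
        _ ≤ l * (E' * X) := by gcongr
        _ = E' * (l * X) := by ring
        _ ≤ E' * (Real.exp (4 * l ^ a) * (P * L)) := by gcongr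
        _ ≤ E' * (E * (P * L)) := by gcongr
        _ = _ := by ring

lemma g_side (ha : 0 < a) (ha1 : a < 1) (n : ℕ) (z : ℝ) {x y : ℝ} (hx : x ∈ Ioc (0:ℝ) 1)
    (hy : y ∈ Ioc (0:ℝ) 1) : g a (n+1) z x ≤ 1/2 ↔ g a (n+1) z y ≤ 1/2 := by
  simp only [g]
  rw [H_side ha z (g_mem' ha ha1 n _ hx), H_side ha z (g_mem' ha ha1 n _ hy)]

lemma g_W {W : Set ℝ} (hW : ∀ z, ∀ x ∈ W, H a z x ∈ W) (n : ℕ) : ∀ z, ∀ x ∈ W, g a n z x ∈ W := by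
  induction n with
  | zero => intro z x hx; exact hx
  | succ n ih => intro z x hx; exact hW _ _ (ih _ _ hx)

/-- the coboundary estimate along an inverse branch -/
lemma cob_est {G : Type*} [MetricSpace G] [AddCommGroup G]
    (hsub : ∀ x y x' y' : G, dist (x - y) (x' - y') ≤ dist x x' + dist y y')
    (ha : 0 < a) (ha1 : a < 1) {κ γ : ℝ} (hκ : κ ≤ a) (hκγ : κ ≤ γ) (hγ : 0 < γ)
    {f u : ℝ → G} {Cf : ℝ} (hCf : 0 ≤ Cf)
    (hf : ∀ x ∈ Ioc (0:ℝ) 1, ∀ y ∈ Ioc (0:ℝ) 1, (x ≤ 1/2 ↔ y ≤ 1/2) →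
      dist (f x) (f y) ≤ Cf * |x - y| ^ γ)
    {W : Set ℝ} (hW1 : W ⊆ Ioc 0 1) (hW : ∀ z, ∀ x ∈ W, H a z x ∈ W)
    (hc : ∀ x ∈ W, f x = u x - u (lsv a x)) {K : ℝ} (n : ℕ) :
    ∀ z, D a κ n z ≤ K → ∀ x ∈ W, ∀ y ∈ W, 
      dist (u x) (u y) ≤ dist (u (g a n z x)) (u (g a n z y)) +
        Cf * Real.exp (4 * K) ^ γ * D a κ n z * |x - y| ^ γ := by
  induction n with
  | zero => intro z _ x _ y _; simp [g, D]
  | succ n ih =>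
    intro z hK x hx y hy
    have hlp := ell_pos ha ha1 (n+1) z
    have hD : D a κ (n+1) z = ell a (n+1) z ^ κ + D a κ n (lsv a z) := rfl
    have hlκ := Real.rpow_nonneg hlp.le κ
    have i := ih (lsv a z) (by linarith) x hx y hy
    have gx := g_W hW n (lsv a z) x hx
    have gy := g_W hW n (lsv a z) y hy
    have ux : u (g a n (lsv a z) x) = u (g a (n+1) z x) - f (g a (n+1) z x) := by
      have := hc _ (g_W hW (n+1) z x hx)
      rw [this]
      simp only [g]
      rw [lsv_H ha z (hW1 gx)]; abel
    have uy : u (g a n (lsv a z) y) = u (g a (n+1) z y) - f (g a (n+1) z y) := by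
      have := hc _ (g_W hW (n+1) z y hy)
      rw [this]
      simp only [g]
      rw [lsv_H ha z (hW1 gy)]; abel
    rw [ux, uy] at i
    have j := hsub (u (g a (n+1) z x)) (f (g a (n+1) z x)) (u (g a (n+1) z y)) (f (g a (n+1) z y))
    have k := hf _ (g_mem' ha ha1 (n+1) z (hW1 hx)) _ (g_mem' ha ha1 (n+1) z (hW1 hy))
      (g_side ha ha1 n z (hW1 hx) (hW1 hy))
    have m : |g a (n+1) z x - g a (n+1) z y| ≤ Real.exp (4 * K) * (ell a (n+1) z * |x - y|) := by
      have hexp : Real.exp (4 * D a κ (n+1) z) ≤ Real.exp (4 * K) := Real.exp_le_exp.2 (by linarith)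
      rcases lt_trichotomy x y with h | h | h
      · have := (g_distort ha ha1 hκ (n+1) z (hW1 hx).1.le h (hW1 hy).2).1
        have h' := g_lt ha ha1 (n+1) z (hW1 hx).1.le h (hW1 hy).2
        rw [abs_sub_comm, abs_of_pos (by linarith), abs_sub_comm, abs_of_pos (by linarith)]
        refine this.trans ?_
        have : 0 ≤ y - x := by linarith
        gcongr
      · subst h; simp
      · have := (g_distort ha ha1 hκ (n+1) z (hW1 hy).1.le h (hW1 hx).2).1
        have h' := g_lt ha ha1 (n+1) z (hW1 hy).1.le h (hW1 hx).2
        rw [abs_of_pos (by linarith), abs_of_pos (by linarith)]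
        refine this.trans ?_
        have : 0 ≤ x - y := by linarith
        gcongr
    have m2 : |g a (n+1) z x - g a (n+1) z y| ^ γ ≤
        Real.exp (4 * K) ^ γ * (ell a (n+1) z ^ κ * |x - y| ^ γ) := by
      calc _ ≤ (Real.exp (4 * K) * (ell a (n+1) z * |x - y|)) ^ γ :=
            Real.rpow_le_rpow (abs_nonneg _) m hγ.le
        _ = Real.exp (4 * K) ^ γ * (ell a (n+1) z ^ γ * |x - y| ^ γ) := by
            rw [Real.mul_rpow (Real.exp_pos _).le (by positivity),
              Real.mul_rpow hlp.le (abs_nonneg _)]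
        _ ≤ _ := by
            have := Real.rpow_le_rpow_of_exponent_ge hlp (ell_le_one ha (n+1) z) hκγ
            gcongr
    have m3 := mul_le_mul_of_nonneg_left m2 hCf
    rw [hD]
    calc _ ≤ _ := i
      _ ≤ (dist (u (g a (n+1) z x)) (u (g a (n+1) z y)) + 
          Cf * (Real.exp (4 * K) ^ γ * (ell a (n+1) z ^ κ * |x - y| ^ γ))) + 
          Cf * Real.exp (4 * K) ^ γ * D a κ n (lsv a z) * |x - y| ^ γ := by linarith
      _ = _ := by ring

/-! contraction along good orbits -/

lemma xs_mem (ha : 0 < a) (m : ℕ) : xs a m ∈ Ioc (0:ℝ) 1 := by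
  induction m with
  | zero => simp [xs]
  | succ m ih =>
    have h := h1_spec ha (y := xs a m) ⟨ih.1.le, ih.2⟩
    refine ⟨?_, ?_⟩
    · rcases h.1.1.eq_or_lt with h0 | h0
      · rw [← h0, TL_zero] at h
        linarith [ih.1, h.2]
      · exact h0
    · simp only [xs]; linarith [h.1.2]

lemma xs_le_half (ha : 0 < a) (m : ℕ) : xs a (m+1) ≤ 1/2 :=
  (h1_spec ha (y := xs a m) ⟨(xs_mem ha m).1.le, (xs_mem ha m).2⟩).1.2

lemma xs_step (ha : 0 < a) (m : ℕ) : TL a (xs a (m+1)) = xs a m :=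
  (h1_spec ha (y := xs a m) ⟨(xs_mem ha m).1.le, (xs_mem ha m).2⟩).2

lemma xs_tendsto (ha : 0 < a) : Filter.Tendsto (xs a) Filter.atTop (nhds 0) := by
  have hanti : Antitone (xs a) := by
    refine antitone_nat_of_succ_le fun m => ?_
    have := TL_expand1 ha le_rfl (xs_mem ha (m+1)).1.le
    rw [xs_step ha, TL_zero] at this
    linarith
  have hb : BddBelow (range (xs a)) := ⟨0, by rintro _ ⟨m, rfl⟩; exact (xs_mem ha m).1.le⟩
  have hl := tendsto_atTop_ciInf hanti hb
  set L := ⨅ i, xs a i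
  have hl0 : 0 ≤ L := le_ciInf fun m => (xs_mem ha m).1.le
  have h2 : Filter.Tendsto (fun m => TL a (xs a (m+1))) Filter.atTop (nhds (TL a L)) :=
    ((TL_cont ha).tendsto L).comp (hl.comp (Filter.tendsto_add_atTop_nat 1))
  simp only [xs_step ha] at h2
  have h3 := tendsto_nhds_unique h2 hl
  have : L = 0 := by
    rcases hl0.eq_or_lt with h | h
    · exact h.symm
    · have := Real.rpow_pos_of_pos h a
      have h2 : 0 < (2:ℝ)^a := by positivity
      have : 0 < L * (2^a * L^a) := by positivity
      unfold TL at h3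
      nlinarith
  rwa [this] at hl

lemma xs_le_g (ha : 0 < a) (ha1 : a < 1) (m : ℕ) : ∀ n z, z ∈ Icc (0:ℝ) 1 → xs a m < z → m ≤ n →
    xs a m ≤ g a n z 0 := by
  induction m with
  | zero => intro n z hz h; simp [xs] at h; linarith [hz.2]
  | succ m ih =>
    intro n z hz h hn
    obtain ⟨n, rfl⟩ : ∃ k, n = k + 1 := ⟨n - 1, by omega⟩
    simp only [g]
    have hg := g_mem ha n (lsv a z) (y := 0) (by simp)
    by_cases hz2 : z ≤ 1/2
    · have := ih n (lsv a z) (lsv_mem ha hz) (by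
        rw [lsv_le hz2, ← xs_step ha]
        have := TL_expand1 ha (xs_mem ha (m+1)).1.le h.le
        linarith) (by omega)
      have := H_mono ha ha1 z (xs_mem ha m).1.le this hg.2
      refine le_trans (le_of_eq ?_) this
      simp only [H, if_pos hz2, xs]
    · have := xs_le_half ha m
      simp only [H, if_neg hz2]
      linarith [hg.1]

lemma V_succ (s : ℝ) (n : ℕ) (z : ℝ) :
    V a s (n+1) z = V a s n (lsv a z) + (if s < z then 1 else 0) := by
  unfold V
  rw [Finset.sum_range_succ']
  rfl

lemma V_le (s : ℝ) (n : ℕ) (z : ℝ) : V a s n z ≤ n := by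
  unfold V
  calc _ ≤ ∑ j ∈ Finset.range n, 1 := Finset.sum_le_sum fun j _ => by split_ifs <;> simp
    _ = n := by simp

lemma V_add (s : ℝ) (j k : ℕ) (z : ℝ) :
    V a s (j + k) z = V a s j z + V a s k ((lsv a)^[j] z) := by
  unfold V
  rw [Finset.sum_range_add]
  congr 1
  refine Finset.sum_congr rfl fun i _ => ?_
  rw [← Function.iterate_add_apply, add_comm]

lemma ell_contract (ha : 0 < a) (ha1 : a < 1) (m : ℕ) {lam : ℝ}
    (hlam : lam = (1 + (2:ℝ)^a * (xs a (m+1)) ^ a)⁻¹) (n : ℕ) : ∀ z ∈ Icc (0:ℝ) 1,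
    ell a n z * lam ^ (m+1) ≤ lam ^ (V a (xs a (m+1)) n z) := by
  have hs := xs_mem ha (m+1)
  have h2 : 0 < (2:ℝ)^a * (xs a (m+1)) ^ a := by
    have := Real.rpow_pos_of_pos hs.1 a
    positivity
  have hl0 : 0 < lam := by rw [hlam]; positivity
  have hl1 : lam ≤ 1 := by rw [hlam]; exact inv_le_one_of_one_le₀ (by linarith)
  induction n with
  | zero =>
    intro z hz
    simp only [ell, g, V, Finset.range_zero, Finset.sum_empty, pow_zero]
    have := pow_le_one₀ (n := m+1) hl0.le hl1
    linarith
  | succ n ih =>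
    intro z hz
    by_cases hn : n + 1 ≤ m + 1
    · have h3 := ell_le_one ha (n+1) z
      have h4 : lam ^ (m+1) ≤ lam ^ (V a (xs a (m+1)) (n+1) z) :=
        pow_le_pow_of_le_one hl0.le hl1 ((V_le _ _ _).trans hn)
      have : 0 < lam ^ (m+1) := by positivity
      nlinarith
    · have ih' := ih (lsv a z) (lsv_mem ha hz)
      have k0 := (g_mem ha n (lsv a z) (y := 0) (by simp)).1
      have k1 := (g_mem ha n (lsv a z) (y := 1) (by simp)).2
      have k5 := g_lt ha ha1 n (lsv a z) (le_refl 0) one_pos le_rfl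
      rw [V_succ]
      by_cases hz2 : xs a (m+1) < z
      · rw [if_pos hz2, pow_succ lam (V a _ _ _)]
        have h6 := xs_le_g ha ha1 (m+1) (n+1) z hz hz2 (by omega)
        have h7 := H_expand ha ha1 z k0 k5.le k1 hs.1.le (xs_le_half ha m) h6
        change _ * ell a (n+1) z ≤ ell a n (lsv a z) at h7
        have h8 : ell a (n+1) z ≤ ell a n (lsv a z) * lam := by
          rw [hlam, ← div_eq_mul_inv, le_div_iff₀ (by linarith)]; linarith
        calc _ ≤ (ell a n (lsv a z) * lam) * lam^(m+1) := by gcongr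
          _ = (ell a n (lsv a z) * lam^(m+1)) * lam := by ring
          _ ≤ _ := by gcongr
      · rw [if_neg hz2, add_zero]
        have h7 := H_contract ha ha1 z k0 k5.le k1
        change ell a (n+1) z ≤ ell a n (lsv a z) at h7
        refine le_trans ?_ ih'
        gcongr

lemma D_geom (ha : 0 < a) (ha1 : a < 1) {κ c ρ : ℝ} (hκ : 0 < κ) (hc : 0 ≤ c) (hρ : 0 ≤ ρ) (n : ℕ) :
    ∀ z, (∀ j < n, ell a (n - j) ((lsv a)^[j] z) ≤ c * ρ ^ (n - j)) →
    D a κ n z ≤ c ^ κ * ∑ k ∈ Finset.range n, (ρ ^ κ) ^ (k + 1) := by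
  induction n with
  | zero => intro z _; simp [D]
  | succ n ih =>
    intro z h
    have h0 := h 0 (by omega)
    simp only [Function.iterate_zero, id, Nat.sub_zero] at h0
    have h1 := ih (lsv a z) (fun j hj => by
      have := h (j+1) (by omega)
      simpa using this)
    rw [Finset.sum_range_succ, D]
    have h2 : ell a (n+1) z ^ κ ≤ c ^ κ * (ρ ^ κ) ^ (n+1) := by
      calc _ ≤ (c * ρ ^ (n+1)) ^ κ := Real.rpow_le_rpow (ell_pos ha ha1 _ _).le h0 hκ.le
        _ = _ := by
          rw [Real.mul_rpow hc (by positivity), ← Real.rpow_natCast, ← Real.rpow_natCast,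
            ← Real.rpow_mul hρ, ← Real.rpow_mul hρ, mul_comm κ]
    linarith

lemma good_of_freq (ha : 0 < a) (ha1 : a < 1) {κ : ℝ} (hκ : 0 < κ) (m : ℕ) {z : ℝ}
    (hz : z ∈ Icc (0:ℝ) 1)
    (hfr : ∀ N : ℕ, ∃ n ≥ N, (n:ℝ) / 2 ≤ V a (xs a (m+1)) n z) :
    ∃ K, ∀ δ > 0, ∃ n, D a κ n z ≤ K ∧ ell a n z ≤ δ := by
  obtain ⟨lam, hlam⟩ : ∃ lam, lam = (1 + (2:ℝ)^a * (xs a (m+1)) ^ a)⁻¹ := ⟨_, rfl⟩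
  have hs := xs_mem ha (m+1)
  have h2 : 0 < (2:ℝ)^a * (xs a (m+1)) ^ a := by
    have := Real.rpow_pos_of_pos hs.1 a
    positivity
  have hl0 : 0 < lam := by rw [hlam]; positivity
  have hl1 : lam < 1 := by rw [hlam]; exact inv_lt_one_of_one_lt₀ (by linarith)
  set ρ := lam ^ (1/4:ℝ) with hρ
  have hρ0 : 0 < ρ := Real.rpow_pos_of_pos hl0 _
  have hρ1 : ρ < 1 := Real.rpow_lt_one hl0.le hl1 (by norm_num)
  set c := (lam ^ (m+1))⁻¹ with hcdef
  have hc : 0 < c := by positivity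
  have hρκ0 : 0 < ρ ^ κ := Real.rpow_pos_of_pos hρ0 _
  have hρκ1 : ρ ^ κ < 1 := Real.rpow_lt_one hρ0.le hρ1 hκ
  -- records
  have hrecs : ∀ N : ℕ, ∃ n ≥ N, ∀ j < n, ell a (n - j) ((lsv a)^[j] z) ≤ c * ρ ^ (n - j) := by
    intro N
    set s := xs a (m+1)
    have ex : ∃ n : ℕ, (N:ℝ) ≤ V a s n z - (n:ℝ)/4 := by
      obtain ⟨n, hn, h⟩ := hfr (4 * N)
      have : (4 * N : ℝ) ≤ n := by exact_mod_cast hn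
      exact ⟨n, by linarith⟩
    classical
    have hf := Nat.find_spec ex
    have hmin := fun j => Nat.find_min ex (m := j)
    set n := Nat.find ex
    refine ⟨n, ?_, ?_⟩
    · have : (V a s n z : ℝ) ≤ n := by exact_mod_cast V_le s n z
      have : (N:ℝ) ≤ n := by
        have : (0:ℝ) ≤ n := Nat.cast_nonneg n
        linarith
      exact_mod_cast this
    · intro j hj
      have h1 := hmin j hj
      push Not at h1
      have hadd := V_add (a := a) s j (n - j) z
      rw [Nat.add_sub_cancel' hj.le] at hadd
      have hadd' : (V a s n z : ℝ) = V a s j z + V a s (n-j) ((lsv a)^[j] z) := by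
        exact_mod_cast hadd
      have hcast : ((n - j : ℕ) : ℝ) = n - j := by
        rw [Nat.cast_sub hj.le]
      have hV : ((n - j : ℕ) : ℝ) / 4 ≤ V a s (n-j) ((lsv a)^[j] z) := by
        rw [hcast]; linarith
      have hcon := ell_contract ha ha1 m hlam (n-j) _ (iter_mem ha j hz)
      have : lam ^ (V a s (n-j) ((lsv a)^[j] z)) ≤ ρ ^ (n-j) := by
        rw [hρ, ← Real.rpow_natCast, ← Real.rpow_natCast, ← Real.rpow_mul hl0.le]
        exact Real.rpow_le_rpow_of_exponent_ge hl0 hl1.le (by linarith)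
      rw [hcdef, inv_mul_eq_div, le_div_iff₀ (by positivity)]
      exact hcon.trans this
  refine ⟨c ^ κ * (ρ ^ κ * (1 - ρ ^ κ)⁻¹), fun δ hδ => ?_⟩
  have ht : Filter.Tendsto (fun n : ℕ => c * ρ ^ n) Filter.atTop (nhds 0) := by
    simpa using (tendsto_pow_atTop_nhds_zero_of_lt_one hρ0.le hρ1).const_mul c
  obtain ⟨N, hN⟩ := Filter.eventually_atTop.1 (ht.eventually_le_const hδ)
  obtain ⟨n, hn, hrec⟩   := hrecs (N + 1)
  refine ⟨n, ?_, ?_⟩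
  · refine (D_geom ha ha1 hκ hc.le hρ0.le n z hrec).trans ?_
    gcongr
    simp_rw [pow_succ']
    rw [← Finset.mul_sum]
    gcongr
    rw [← tsum_geometric_of_lt_one hρκ0.le hρκ1]
    exact (summable_geometric_of_lt_one hρκ0.le hρκ1).sum_le_tsum _ (fun i _ => by positivity)
  · have := hrec 0 (by omega)
    simp only [Function.iterate_zero, id, Nat.sub_zero] at this
    exact this.trans (hN n (by omega))

end
end LSV

open MeasureTheory Set
namespace LSV

/-- Lebesgue measure on the unit interval -/
noncomputable abbrev mu : Measure ℝ := volume.restrict (Icc (0:ℝ) 1)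

/-- distribution function of the `n`-th image of Lebesgue measure -/
noncomputable def M (a : ℝ) (n : ℕ) (s : ℝ) : ℝ := mu.real {z | (lsv a)^[n] z ≤ s}

section
variable {a : ℝ}

lemma lsv_meas (a : ℝ) : Measurable (lsv a) := by
  unfold lsv
  exact Measurable.ite measurableSet_Iic (by fun_prop) (by fun_prop)

lemma iter_meas (a : ℝ) (n : ℕ) : Measurable (lsv a)^[n] := (lsv_meas a).iterate n

lemma le_meas (a : ℝ) (n : ℕ) (s : ℝ) : MeasurableSet {z | (lsv a)^[n] z ≤ s} :=
  measurableSet_le (iter_meas a n) measurable_const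

lemma mu_univ : mu univ = 1 := by simp [mu]

lemma lsv_le_iff (ha : 0 < a) {w s : ℝ} (hw : w ∈ Icc (0:ℝ) 1) (hs : s ∈ Icc (0:ℝ) 1) :
    lsv a w ≤ s ↔ (w ≤ h1 a s ∨ (w ≤ (s+1)/2 ∧ ¬ w ≤ 1/2)) := by
  have h := h1_spec ha hs
  by_cases hw2 : w ≤ 1/2
  · rw [lsv_le hw2]
    conv_lhs => rw [← h.2]
    rw [TL_strictMono ha hw.1 h.1.1]
    constructor
    · exact Or.inl
    · rintro (h' | h')
      · exact h'
      · exact absurd hw2 h'.2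
  · have hw3 := hw2
    push Not at hw3
    rw [lsv_gt hw3]
    constructor
    · intro h'; right; exact ⟨by linarith, hw2⟩
    · rintro (h' | h')
      · linarith [h.1.2]
      · linarith [h'.1]

lemma M_mono (n : ℕ) {s t : ℝ} (h : s ≤ t) : M a n s ≤ M a n t :=
  measureReal_mono (fun z hz => le_trans hz h)

lemma M_nonneg (n : ℕ) (s : ℝ) : 0 ≤ M a n s := measureReal_nonneg

lemma M_le_one (n : ℕ) (s : ℝ) : M a n s ≤ 1 := by
  have : M a n s ≤ mu.real univ := measureReal_mono (subset_univ _)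
  simpa [measureReal_def, mu_univ] using this

lemma M_zero {s : ℝ} (hs : s ∈ Icc (0:ℝ) 1) : M a 0 s = s := by
  unfold M mu
  rw [measureReal_restrict_apply (le_meas a 0 s)]
  have : {z | (lsv a)^[0] z ≤ s} ∩ Icc 0 1 = Icc 0 s := by
    ext z; simp only [Function.iterate_zero, id, mem_inter_iff, mem_ofPred_eq, mem_Icc]
    constructor
    · rintro ⟨h1, h2, h3⟩; exact ⟨h2, h1⟩
    · rintro ⟨h1, h2⟩; exact ⟨h2, h1, h2.trans hs.2⟩
  rw [this]
  simp [hs.1]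

lemma M_succ (ha : 0 < a) (n : ℕ) {s : ℝ} (hs : s ∈ Icc (0:ℝ) 1) :
    M a (n+1) s = M a n (h1 a s) + (M a n ((s+1)/2) - M a n (1/2)) := by
  have h := h1_spec ha hs
  have hset : ({z | (lsv a)^[n+1] z ≤ s} : Set ℝ) =ᵐ[mu]
      ({z | (lsv a)^[n] z ≤ h1 a s} ∪
        ({z | (lsv a)^[n] z ≤ (s+1)/2} \ {z | (lsv a)^[n] z ≤ 1/2}) : Set ℝ) := by
    filter_upwards [ae_restrict_mem measurableSet_Icc] with z hz
    have := lsv_le_iff ha (iter_mem ha n hz) hs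
    rw [← Function.iterate_succ_apply' (lsv a)] at this
    exact propext this
  unfold M
  rw [measureReal_congr hset, measureReal_union, measureReal_sdiff]
  · intro z hz
    have : (lsv a)^[n] z ≤ 1/2 := hz
    exact this.trans (by linarith [hs.1])
  · exact le_meas a n _
  · rw [Set.disjoint_left]
    intro z hz hz2
    exact hz2.2 (le_trans hz h.1.2)
  · exact (le_meas a n _).diff (le_meas a n _)

lemma M_concave (ha : 0 < a) (n : ℕ) : ConcaveOn ℝ (Icc 0 1) (M a n) := by
  induction n with
  | zero =>
    refine (concaveOn_id (convex_Icc (0:ℝ) 1)).congr ?_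
    intro x hx; exact (M_zero hx).symm
  | succ n ih =>
    refine ⟨convex_Icc _ _, ?_⟩
    intro x hx y hy s t hs ht hst
    have hz := (convex_Icc (0:ℝ) 1) hx hy hs ht hst
    rw [M_succ ha n hx, M_succ ha n hy, M_succ ha n hz]
    have e1 := h1_spec ha hx
    have e2 := h1_spec ha hy
    have c1 := (h1_concave ha).2 hx hy hs ht hst
    have c2 := M_mono (a := a) n c1
    have c3 := ih.2 (x := h1 a x) (y := h1 a y) ⟨e1.1.1, by linarith [e1.1.2]⟩
      ⟨e2.1.1, by linarith [e2.1.2]⟩ hs ht hst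
    have c4 := ih.2 (x := (x+1)/2) (y := (y+1)/2) ⟨by linarith [hx.1], by linarith [hx.2]⟩
      ⟨by linarith [hy.1], by linarith [hy.2]⟩ hs ht hst
    have e : s • ((x+1)/2) + t • ((y+1)/2) = (s • x + t • y + 1)/2 := by
      simp only [smul_eq_mul]; linear_combination hst / 2
    rw [e] at c4
    have e' : s * M a n (1/2) + t * M a n (1/2) = M a n (1/2) := by rw [← add_mul, hst, one_mul]
    simp only [smul_eq_mul] at *
    linarith

lemma M_right (ha : 0 < a) (n : ℕ) {s : ℝ} (hs : s ∈ Icc (0:ℝ) 1) :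
    M a n ((s+1)/2) - M a n (1/2) ≤ s := by
  rcases hs.1.eq_or_lt with h | h
  · subst h; simp
  have := (M_concave ha n).slope_anti_adjacent (x := 0) (y := 1/2) (z := (s+1)/2) (by simp)
    ⟨by linarith, by linarith [hs.2]⟩ (by norm_num) (by linarith)
  have h1 := M_nonneg (a := a) n 0
  have h2 := M_le_one (a := a) n (1/2)
  rw [div_le_div_iff₀ (by linarith) (by norm_num)] at this
  nlinarith

lemma exists_tight (ha : 0 < a) (ha1 : a < 1) : ∃ C : ℝ, 0 < C ∧ ∀ n, ∀ s ∈ Icc (0:ℝ) 1,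
    M a n s ≤ C * s ^ (1 - a) := by
  set c := (2:ℝ)^(1-a) - 1 with hc
  have hc0 : 0 < c := by
    have := Real.one_lt_rpow (x := 2) (z := 1 - a) (by norm_num) (by linarith)
    linarith
  have hc1 : c ≤ 1 := by
    have : (2:ℝ)^(1-a) ≤ 2^(1:ℝ) := Real.rpow_le_rpow_of_exponent_le (by norm_num) (by linarith)
    rw [Real.rpow_one] at this
    linarith
  refine ⟨2 / c, by positivity, fun n => ?_⟩
  have hC1 : 1 ≤ 2 / c := by rw [le_div_iff₀ hc0]; linarith
  induction n with
  | zero =>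
    intro s hs
    rw [M_zero hs]
    have : s ≤ s ^ (1 - a) := by
      rcases hs.1.eq_or_lt with h | h
      · rw [← h]; positivity
      · have := Real.rpow_le_rpow_of_exponent_ge h hs.2 (show 1 - a ≤ 1 by linarith)
        rwa [Real.rpow_one] at this
    have h0 : 0 ≤ s ^ (1 - a) := hs.1.trans this
    nlinarith
  | succ n ih =>
    intro s hs
    rw [M_succ ha n hs]
    have h := h1_spec ha hs
    have k1 := M_right (a := a) ha n hs
    set y := h1 a s
    have k2 := ih y ⟨h.1.1, by linarith [h.1.2]⟩
    have hy := h.1.1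
    set t := (2:ℝ)^a * y^a with ht
    have ht0 : 0 ≤ t := by positivity
    have ht1 : t ≤ 1 := by
      rw [← two_rpow_mul_half a]
      exact mul_le_mul_of_nonneg_left (Real.rpow_le_rpow hy h.1.2 ha.le) (by positivity)
    have hs' : s = y * (1 + t) := h.2.symm
    have conc := (Real.concaveOn_rpow (p := 1 - a) (by linarith) (by linarith)).2
      (show (1:ℝ) ∈ Ici 0 by simp) (show (2:ℝ) ∈ Ici 0 by simp)
      (show 0 ≤ 1 - t by linarith) ht0 (by ring)
    simp only [smul_eq_mul, Real.one_rpow] at conc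
    rw [show (1 - t) * 1 + t * 2 = 1 + t by ring] at conc
    have hyy : y ^ (1 - a) * y ^ a = y := by
      rw [← Real.rpow_add_of_nonneg hy (by linarith) ha.le]; simp
    have h2a : 1 ≤ (2:ℝ)^a := Real.one_le_rpow (by norm_num) ha.le
    have hyt : y ≤ y ^ (1 - a) * t := by
      rw [ht, mul_left_comm, hyy]; nlinarith
    have hs2 : s ^ (1 - a) = y ^ (1 - a) * (1 + t) ^ (1 - a) := by
      rw [hs', Real.mul_rpow hy (by linarith)]
    have hy0 : 0 ≤ y ^ (1 - a) := by positivity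
    have k3 : y ^ (1 - a) + c * y ≤ s ^ (1 - a) := by
      rw [hs2]
      calc y ^ (1 - a) + c * y ≤ y ^ (1 - a) + c * (y ^ (1 - a) * t) := by gcongr
        _ = y ^ (1 - a) * ((1 - t) * 1 + t * 2 ^ (1 - a)) := by rw [hc]; ring
        _ ≤ _ := by gcongr
    have k4 : 2 / c * (y ^ (1 - a) + c * y) ≤ 2 / c * s ^ (1 - a) := by gcongr
    have k5 : 2 / c * (y ^ (1 - a) + c * y) = 2 / c * y ^ (1 - a) + 2 * y := by field_simp
    have : s ≤ 2 * y := by rw [hs']; nlinarith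
    linarith

lemma bad_le (n : ℕ) (hn : 0 < n) {s B : ℝ} (hB : ∀ j, M a j s ≤ B) :
    mu {z | (V a s n z : ℝ) < (n:ℝ)/2} ≤ ENNReal.ofReal (2 * B) := by
  have hB0 : 0 ≤ B := (M_nonneg 0 s).trans (hB 0)
  set F : ℝ → ENNReal := fun z => ∑ j ∈ Finset.range n,
    ({z | (lsv a)^[j] z ≤ s} : Set ℝ).indicator 1 z with hF
  have hFm : Measurable F := by
    refine Finset.measurable_fun_sum _ fun j _ => ?_
    exact measurable_one.indicator (le_meas a j s)
  have hFi : ∫⁻ z, F z ∂mu ≤ ENNReal.ofReal (n * B) := by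
    rw [hF, lintegral_finsetSum _ (fun j _ => measurable_one.indicator (le_meas a j s))]
    calc _ ≤ ∑ j ∈ Finset.range n, ENNReal.ofReal B := by
          refine Finset.sum_le_sum fun j _ => ?_
          rw [lintegral_indicator_one (le_meas a j s)]
          rw [← ofReal_measureReal]
          exact ENNReal.ofReal_le_ofReal (hB j)
      _ = _ := by
        rw [Finset.sum_const, Finset.card_range, nsmul_eq_mul, ENNReal.ofReal_mul (by positivity),
          ENNReal.ofReal_natCast]
  have hFV : ∀ z, F z = ((n - V a s n z : ℕ) : ENNReal) := by
    intro z
    have : (n - V a s n z : ℕ) = ∑ j ∈ Finset.range n, if (lsv a)^[j] z ≤ s then 1 else 0 := by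
      rw [Nat.sub_eq_iff_eq_add (V_le s n z)]
      unfold V
      rw [← Finset.sum_add_distrib]
      have : ∀ j ∈ Finset.range n, ((if (lsv a)^[j] z ≤ s then 1 else 0) +
          (if s < (lsv a)^[j] z then 1 else 0)) = 1 := by
        intro j _
        by_cases h : (lsv a)^[j] z ≤ s
        · rw [if_pos h, if_neg (not_lt.2 h)]
        · rw [if_neg h, if_pos (not_le.1 h)]
      rw [Finset.sum_congr rfl this]; simp
    rw [this, hF]
    push_cast
    refine Finset.sum_congr rfl fun j _ => ?_
    simp only [indicator_apply, mem_ofPred_eq, Pi.one_apply]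
  have hsub : {z | (V a s n z : ℝ) < (n:ℝ)/2} ⊆ {z | ENNReal.ofReal ((n:ℝ)/2) ≤ F z} := by
    intro z hz
    have hz : (V a s n z : ℝ) < (n:ℝ)/2 := hz
    simp only [mem_ofPred_eq, hFV]
    rw [← ENNReal.ofReal_natCast, Nat.cast_sub (V_le s n z)]
    exact ENNReal.ofReal_le_ofReal (by linarith)
  have hmk := mul_meas_ge_le_lintegral (μ := mu) hFm (ENNReal.ofReal ((n:ℝ)/2))
  have hn' : (0:ℝ) < n := by exact_mod_cast hn
  have e : ENNReal.ofReal (n * B) = ENNReal.ofReal ((n:ℝ)/2) * ENNReal.ofReal (2 * B) := by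
    rw [← ENNReal.ofReal_mul (by positivity)]; ring_nf
  have h2 := hmk.trans hFi
  rw [e] at h2
  exact (measure_mono hsub).trans ((ENNReal.mul_le_mul_iff_right
    (by simpa using hn) ENNReal.ofReal_ne_top).1 h2)

lemma ae_freq (ha : 0 < a) (ha1 : a < 1) : ∀ᵐ z ∂mu, ∃ m : ℕ,
    ∀ N : ℕ, ∃ n ≥ N, (n:ℝ) / 2 ≤ V a (xs a (m+1)) n z := by
  obtain ⟨C, hC, hM⟩ := exists_tight ha ha1
  have hb : ∀ m, mu {z | ∃ N : ℕ, ∀ n ≥ N, (V a (xs a (m+1)) n z : ℝ) < (n:ℝ)/2} ≤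
      ENNReal.ofReal (2 * (C * xs a (m+1) ^ (1 - a))) := by
    intro m
    have hs := xs_mem ha (m+1)
    have e : {z | ∃ N : ℕ, ∀ n ≥ N, (V a (xs a (m+1)) n z : ℝ) < (n:ℝ)/2} =
        ⋃ N : ℕ, {z | ∀ n ≥ N, (V a (xs a (m+1)) n z : ℝ) < (n:ℝ)/2} := by
      ext z; simp
    rw [e, Monotone.measure_iUnion]
    · refine iSup_le fun N => ?_
      refine le_trans (measure_mono ?_) (bad_le (N+1) (by omega) 
        (fun j => hM j _ ⟨hs.1.le, hs.2⟩))
      intro z hz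
      exact hz (N+1) (by omega)
    · intro N N' h z hz n hn
      exact hz n (le_trans h hn)
  rw [ae_iff]
  have ht : Filter.Tendsto (fun m => ENNReal.ofReal (2 * (C * xs a (m+1) ^ (1 - a))))
      Filter.atTop (nhds 0) := by
    have h1 : Filter.Tendsto (fun m => xs a (m+1)) Filter.atTop (nhds 0) :=
      (xs_tendsto ha).comp (Filter.tendsto_add_atTop_nat 1)
    have h2 := h1.rpow_const (p := 1 - a) (Or.inr (by linarith))
    rw [Real.zero_rpow (by linarith)] at h2
    have h3 := (h2.const_mul C).const_mul 2
    simpa using ENNReal.tendsto_ofReal h3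
  refine le_antisymm (ge_of_tendsto' ht fun m => ?_) (zero_le)
  refine (measure_mono ?_).trans (hb m)
  intro z hz
  simp only [mem_ofPred_eq] at hz ⊢
  push Not at hz
  exact hz m

lemma ae_good (ha : 0 < a) (ha1 : a < 1) {κ : ℝ} (hκ : 0 < κ) : ∀ᵐ z ∂mu,
    ∃ K, ∀ δ > 0, ∃ n, D a κ n z ≤ K ∧ ell a n z ≤ δ := by
  filter_upwards [ae_freq ha ha1, ae_restrict_mem measurableSet_Icc] with z ⟨m, hm⟩ hz
  exact good_of_freq ha ha1 hκ m hz hm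

end
end LSV

open MeasureTheory Set
namespace LSV

section
variable {a : ℝ}

lemma vol_le_of_expand (φ : ℝ → ℝ) (B : Set ℝ) {c : ℝ} (hc : 0 < c)
    (h : ∀ x ∈ B, ∀ y ∈ B, c * |x - y| ≤ |φ x - φ y|) :
    volume B ≤ ENNReal.ofReal (1/c) * volume (φ '' B) := by
  have hinj : InjOn φ B := by
    intro x hx y hy hxy
    have := h x hx y hy
    rw [hxy, sub_self, abs_zero] at this
    have h2 : |x - y| ≤ 0 := by
      by_contra h3
      push Not at h3
      nlinarith
    exact sub_eq_zero.1 (abs_nonpos_iff.1 h2)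
  have hL : LipschitzOnWith (Real.toNNReal (1/c)) (Function.invFunOn φ B) (φ '' B) := by
    apply LipschitzOnWith.of_dist_le_mul
    rintro _ ⟨x, hx, rfl⟩ _ ⟨y, hy, rfl⟩
    rw [hinj.leftInvOn_invFunOn hx, hinj.leftInvOn_invFunOn hy, Real.dist_eq, Real.dist_eq,
      Real.coe_toNNReal _ (by positivity), one_div, inv_mul_eq_div, le_div_iff₀ hc, mul_comm]
    exact h x hx y hy
  have := hL.hausdorffMeasure_image_le (d := 1) zero_le_one
  rw [hinj.leftInvOn_invFunOn.image_image, hausdorffMeasure_real, ENNReal.rpow_one] at this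
  exact this

lemma mu_apply (N : Set ℝ) : mu N = volume (N ∩ Icc 0 1) := Measure.restrict_apply' measurableSet_Icc

lemma null_H (ha : 0 < a) (ha1 : a < 1) (z : ℝ) {N : Set ℝ} (hN : mu N = 0) :
    mu {y | H a z y ∈ N} = 0 := by
  rw [mu_apply] at *
  refine le_antisymm ((vol_le_of_expand (H a z) _ (c := 1/3) (by norm_num) ?_).trans ?_) bot_le
  · rintro x ⟨_, hx⟩ y ⟨_, hy⟩
    rcases le_total x y with hxy | hxy
    · have := H_lower ha ha1 z hx.1 hxy hy.2
      rw [abs_sub_comm, abs_of_nonneg (by linarith), abs_sub_comm, abs_of_nonneg (by linarith)]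
      linarith
    · have := H_lower ha ha1 z hy.1 hxy hx.2
      rw [abs_of_nonneg (by linarith), abs_of_nonneg (by linarith)]
      linarith
  · have : volume (H a z '' ({y | H a z y ∈ N} ∩ Icc 0 1)) = 0 := by
      refine measure_mono_null ?_ hN
      rintro _ ⟨y, ⟨h1, h2⟩, rfl⟩
      exact ⟨h1, H_mem ha z h2⟩
    rw [this, mul_zero]

lemma null_lsv (ha : 0 < a) {N : Set ℝ} (hN : mu N = 0) :
    mu {y | lsv a y ∈ N} = 0 := by
  rw [mu_apply] at *
  have key : ∀ P : Set ℝ, (∀ x ∈ P, ∀ y ∈ P, 1 * |x - y| ≤ |lsv a x - lsv a y|) →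
      P ⊆ {y | lsv a y ∈ N} ∩ Icc 0 1 → volume P = 0 := by
    intro P h1 h2
    refine le_antisymm ((vol_le_of_expand (lsv a) _ (c := 1) (by norm_num) h1).trans ?_) bot_le
    have : volume (lsv a '' P) = 0 := by
      refine measure_mono_null ?_ hN
      rintro _ ⟨y, h3, rfl⟩
      exact ⟨(h2 h3).1, lsv_mem ha (h2 h3).2⟩
    rw [this, mul_zero]
  set Q := {y | lsv a y ∈ N} ∩ Icc 0 1
  have hQ : Q ⊆ (Q ∩ Iic (1/2)) ∪ (Q ∩ Ioi (1/2)) := by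
    intro x hx
    rcases le_or_gt x (1/2) with h | h
    · exact Or.inl ⟨hx, h⟩
    · exact Or.inr ⟨hx, h⟩
  refine measure_mono_null hQ (measure_union_null (key _ ?_ inter_subset_left)
    (key _ ?_ inter_subset_left))
  · rintro x ⟨hx, hx2⟩ y ⟨hy, hy2⟩
    rw [lsv_le hx2, lsv_le hy2]
    rcases le_total x y with hxy | hxy
    · have := TL_expand1 ha hx.2.1 hxy
      rw [abs_sub_comm, abs_of_nonneg (by linarith), abs_sub_comm, abs_of_nonneg (by linarith)]
      linarith
    · have := TL_expand1 ha hy.2.1 hxy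
      rw [abs_of_nonneg (by linarith), abs_of_nonneg (by linarith)]
      linarith
  · rintro x ⟨hx, hx2⟩ y ⟨hy, hy2⟩
    rw [lsv_gt hx2, lsv_gt hy2, show 2 * x - 1 - (2 * y - 1) = 2 * (x - y) by ring, abs_mul]
    norm_num
    linarith [abs_nonneg (x - y)]

/-- iterated preimages of a null set under the two inverse branches -/
noncomputable def NN (a : ℝ) (N : Set ℝ) : ℕ → Set ℝ
  | 0 => N
  | n+1 => {y | H a 0 y ∈ NN a N n} ∪ {y | H a 1 y ∈ NN a N n}

lemma H_zero_or_one (z : ℝ) : H a z = H a 0 ∨ H a z = H a 1 := by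
  by_cases h : z ≤ 1/2
  · left; ext y; simp only [H, h, if_true]; norm_num
  · right; ext y; simp only [H, h, if_false]; norm_num

lemma exists_W (ha : 0 < a) (ha1 : a < 1) {N : Set ℝ} (hN : mu N = 0) :
    ∃ W : Set ℝ, W ⊆ Ioc 0 1 ∧ (∀ x ∈ W, x ∉ N) ∧ (∀ z, ∀ x ∈ W, H a z x ∈ W) ∧
      ∀ᵐ x ∂mu, x ∈ W := by
  refine ⟨Ioc 0 1 \ ⋃ n, NN a N n, sdiff_subset, ?_, ?_, ?_⟩
  · intro x hx hxN
    exact hx.2 (mem_iUnion.2 ⟨0, hxN⟩)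
  · intro z x hx
    refine ⟨g_mem' ha ha1 1 z hx.1, ?_⟩
    intro h
    obtain ⟨n, hn⟩ := mem_iUnion.1 h
    refine hx.2 (mem_iUnion.2 ⟨n+1, ?_⟩)
    rcases H_zero_or_one (a := a) z with h' | h'
    · left; rw [h'] at hn; exact hn
    · right; rw [h'] at hn; exact hn
  · have h0 : ∀ n, mu (NN a N n) = 0 := by
      intro n
      induction n with
      | zero => exact hN
      | succ n ih => exact measure_union_null (null_H ha ha1 0 ih) (null_H ha ha1 1 ih)
    have h1 : ∀ᵐ x ∂mu, x ∉ ⋃ n, NN a N n := by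
      have := measure_iUnion_null h0
      exact measure_eq_zero_iff_ae_notMem.1 this
    have h2 : ∀ᵐ x ∂mu, x ∈ Ioc (0:ℝ) 1 := by
      have : mu = volume.restrict (Ioc (0:ℝ) 1) := Measure.restrict_congr_set Ioc_ae_eq_Icc.symm
      rw [this]
      exact ae_restrict_mem measurableSet_Ioc
    filter_upwards [h1, h2] with x k1 k2
    exact ⟨k2, k1⟩

lemma density (ha : 0 < a) (ha1 : a < 1) {κ : ℝ} (hκ : 0 < κ) (hκa : κ ≤ a) {A : Set ℝ}
    (hA : MeasurableSet A) (hpos : 0 < mu A) :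
    ∃ z ∈ Icc (0:ℝ) 1, ∃ K, ∀ δ > 0, ∃ n, D a κ n z ≤ K ∧
      volume {y | y ∈ Icc (0:ℝ) 1 ∧ g a n z y ∉ A} ≤ ENNReal.ofReal δ := by
  have e1 := ae_good ha ha1 hκ
  have e2 := IsUnifLocDoublingMeasure.ae_tendsto_measure_inter_div.{0,0} (volume : Measure ℝ) A 1
  have e3 : ∀ᵐ z ∂mu, z ∈ A → ∀ {ι : Type} {l : Filter ι} (w : ι → ℝ) (δ : ι → ℝ)
      (_ : Filter.Tendsto δ l (nhdsWithin 0 (Ioi 0)))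
      (_ : ∀ᶠ j in l, z ∈ Metric.closedBall (w j) (1 * δ j)),
      Filter.Tendsto (fun j => volume (A ∩ Metric.closedBall (w j) (δ j)) /
        volume (Metric.closedBall (w j) (δ j))) l (nhds 1) :=
    ae_restrict_of_ae ((ae_restrict_iff' hA).1 e2)
  have e4 : ∃ᶠ z in ae mu, z ∈ A := by
    rw [frequently_ae_mem_iff]
    exact hpos.ne'
  obtain ⟨z, hzA, ⟨K, hK⟩, e3', hz⟩ := (e4.and_eventually
    (e1.and (e3.and (ae_restrict_mem measurableSet_Icc)))).exists
  refine ⟨z, hz, K, fun δ hδ => ?_⟩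
  choose n hn1 hn2 using fun k : ℕ => hK (1/((k:ℝ)+1)) (by positivity)
  have hell : ∀ k, 0 < ell a (n k) z := fun k => ell_pos ha ha1 _ _
  have hcb : ∀ k, Metric.closedBall ((g a (n k) z 0 + g a (n k) z 1)/2) (ell a (n k) z / 2) =
      Icc (g a (n k) z 0) (g a (n k) z 1) := by
    intro k
    rw [Real.closedBall_eq_Icc]
    unfold ell
    congr 1 <;> ring
  have lim := @e3' hzA ℕ Filter.atTop (fun k => (g a (n k) z 0 + g a (n k) z 1)/2)
    (fun k => ell a (n k) z / 2) ?_ ?_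
  rotate_left
  · rw [tendsto_nhdsWithin_iff]
    constructor
    · have l1 := tendsto_one_div_add_atTop_nhds_zero_nat (𝕜 := ℝ)
      refine squeeze_zero (fun k => ?_) (fun k => ?_) l1
      · have := hell k; positivity
      · have := hell k
        linarith [hn2 k]
    · exact Filter.Eventually.of_forall fun k => by
        have := hell k
        rw [mem_Ioi]
        positivity
  · refine Filter.Eventually.of_forall fun k => ?_
    rw [one_mul, hcb]
    have hT := iter_mem ha (n k) hz
    have := g_self ha (n k) hz
    conv => rw [mem_Icc]
    constructor
    · conv_rhs => rw [← this]
      exact g_le ha ha1 _ _ le_rfl hT.1 hT.2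
    · conv_lhs => rw [← this]
      exact g_le ha ha1 _ _ hT.1 hT.2 le_rfl
  simp only [hcb, Real.volume_Icc] at lim
  have lim2 := (ENNReal.tendsto_toReal ENNReal.one_ne_top).comp lim
  set η := δ * Real.exp (-(4*K)) with hη
  have hη0 : 0 < η := by positivity
  have := (lim2.eventually (lt_mem_nhds (show (1:ENNReal).toReal - η < (1:ENNReal).toReal by
    linarith))).exists
  obtain ⟨k, hk⟩ := this
  refine ⟨n k, hn1 k, ?_⟩
  set I := Icc (g a (n k) z 0) (g a (n k) z 1) with hI
  have hIv : volume I = ENNReal.ofReal (ell a (n k) z) := Real.volume_Icc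
  have hle := hell k
  set L := ell a (n k) z with hL
  have hk2 : (1 - η) * L ≤ volume.real (A ∩ I) := by
    simp only [Function.comp, ENNReal.toReal_div, ENNReal.toReal_one] at hk
    rw [show g a (n k) z 1 - g a (n k) z 0 = L from rfl, ENNReal.toReal_ofReal hle.le,
      lt_div_iff₀ hle] at hk
    exact hk.le
  have hdiff : volume.real (I \ A) ≤ η * L := by
    have h1 := measureReal_inter_add_sdiff (μ := volume) (s := I) hA (by rw [hIv]; simp)
    have h2 : volume.real I = L := by rw [measureReal_def, hIv, ENNReal.toReal_ofReal hle.le]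
    rw [inter_comm] at h1
    linarith
  have hdiff2 : volume (I \ A) ≤ ENNReal.ofReal (η * L) := by
    have hfin : volume (I \ A) ≠ ⊤ := ((measure_mono sdiff_subset).trans_lt
      (by rw [hIv]; exact ENNReal.ofReal_lt_top)).ne
    rw [← ENNReal.ofReal_toReal hfin]
    exact ENNReal.ofReal_le_ofReal hdiff
  have hc : 0 < L * Real.exp (-(4*K)) := by positivity
  have key : ∀ x y, 0 ≤ x → x < y → y ≤ 1 →
      L * Real.exp (-(4*K)) * (y - x) ≤ g a (n k) z y - g a (n k) z x := by
    intro x y h1 h2 h3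
    have := (g_distort ha ha1 hκa (n k) z h1 h2 h3).2
    have hpos := g_lt ha ha1 (n k) z h1 h2 h3
    have hee : Real.exp (4 * D a κ (n k) z) ≤ Real.exp (4*K) :=
      Real.exp_le_exp.2 (by linarith [hn1 k])
    rw [Real.exp_neg, mul_right_comm, ← div_eq_mul_inv, div_le_iff₀ (Real.exp_pos _)]
    nlinarith
  refine (vol_le_of_expand (g a (n k) z) _ hc ?_).trans ?_
  · rintro x ⟨hx, _⟩ y ⟨hy, _⟩
    rcases lt_trichotomy x y with hxy | hxy | hxy
    · have := key x y hx.1 hxy hy.2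
      have h3 := g_lt ha ha1 (n k) z hx.1 hxy hy.2
      rw [abs_sub_comm, abs_of_nonneg (by linarith), abs_sub_comm, abs_of_nonneg (by linarith)]
      exact this
    · subst hxy; simp
    · have := key y x hy.1 hxy hx.2
      have h3 := g_lt ha ha1 (n k) z hy.1 hxy hx.2
      rw [abs_of_nonneg (by linarith), abs_of_nonneg (by linarith)]
      exact this
  · have hsub : g a (n k) z '' {y | y ∈ Icc (0:ℝ) 1 ∧ g a (n k) z y ∉ A} ⊆ I \ A := by
      rintro _ ⟨y, ⟨hy, hyA⟩, rfl⟩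
      exact ⟨⟨g_le ha ha1 _ _ le_rfl hy.1 hy.2, g_le ha ha1 _ _ hy.1 hy.2 le_rfl⟩, hyA⟩
    calc _ ≤ ENNReal.ofReal (1 / (L * Real.exp (-(4*K)))) * ENNReal.ofReal (η * L) := by
          gcongr
          exact (measure_mono hsub).trans hdiff2
      _ = ENNReal.ofReal δ := by
          rw [← ENNReal.ofReal_mul (by positivity)]
          congr 1
          rw [hη]
          field_simp

end
end LSV

open MeasureTheory Set
namespace LSV

section
variable {a : ℝ}

lemma zero_one (ha : 0 < a) (ha1 : a < 1) {W S : Set ℝ}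
    (hW : ∀ z, ∀ x ∈ W, H a z x ∈ W) (hWae : ∀ᵐ x ∂mu, x ∈ W) (hS : MeasurableSet S)
    (hinvS : ∀ z, ∀ x ∈ W, H a z x ∈ S ↔ x ∈ S) (hpos : 0 < mu S) : ∀ᵐ x ∂mu, x ∈ S := by
  obtain ⟨z, hz, K, hK⟩ := density ha ha1 ha le_rfl hS hpos
  have hg : ∀ n z, ∀ x ∈ W, g a n z x ∈ S ↔ x ∈ S := by
    intro n
    induction n with
    | zero => intro z x _; exact Iff.rfl
    | succ n ih =>
      intro z x hx
      exact (hinvS _ _ (g_W hW n _ x hx)).trans (ih _ x hx)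
  have hle : ∀ δ > 0, mu Sᶜ ≤ ENNReal.ofReal δ := by
    intro δ hδ
    obtain ⟨n, _, hn⟩ := hK δ hδ
    refine le_trans ?_ hn
    rw [mu_apply]
    have : volume (Sᶜ ∩ Icc 0 1) = mu Sᶜ := (mu_apply _).symm
    rw [this]
    have h2 : mu Sᶜ ≤ mu {y | y ∈ Icc (0:ℝ) 1 ∧ g a n z y ∉ S} := by
      refine measure_mono_ae ?_
      filter_upwards [hWae, ae_restrict_mem measurableSet_Icc] with x hx1 hx2 hx3
      exact ⟨hx2, fun h => hx3 ((hg n z x hx1).1 h)⟩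
    exact h2.trans (Measure.restrict_apply_le _ _)
  have h0 : mu Sᶜ = 0 := by
    by_contra h
    have hfin : mu Sᶜ ≠ ⊤ := (lt_of_le_of_lt (hle 1 one_pos) ENNReal.ofReal_lt_top).ne
    have hp : 0 < (mu Sᶜ).toReal := ENNReal.toReal_pos h hfin
    have := hle ((mu Sᶜ).toReal / 2) (by positivity)
    rw [← ENNReal.ofReal_toReal hfin, ENNReal.ofReal_le_ofReal_iff (by positivity),
      ENNReal.toReal_ofReal hp.le] at this
    linarith
  exact h0

lemma holder_cont {G : Type*} [PseudoMetricSpace G] {f : ℝ → G} {s : Set ℝ} {C γ : ℝ} (hγ : 0 < γ)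
    (h : ∀ x ∈ s, ∀ y ∈ s, dist (f x) (f y) ≤ C * |x - y| ^ γ) : ContinuousOn f s := by
  intro x hx
  rw [ContinuousWithinAt, tendsto_iff_dist_tendsto_zero]
  have l1 : Filter.Tendsto (fun y => C * |y - x| ^ γ) (nhdsWithin x s) (nhds 0) := by
    have : Continuous (fun y : ℝ => C * |y - x| ^ γ) := by
      have := Real.continuous_rpow_const (q := γ) hγ.le
      fun_prop
    have h2 := this.tendsto x
    simp only [sub_self, abs_zero, Real.zero_rpow hγ.ne', mul_zero] at h2
    exact h2.mono_left nhdsWithin_le_nhds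
  refine squeeze_zero' (Filter.Eventually.of_forall fun _ => dist_nonneg) ?_ l1
  filter_upwards [self_mem_nhdsWithin] with y hy
  exact h y hy x hx

lemma small_osc {G : Type*} [NormedAddCommGroup G] [MeasurableSpace G] [BorelSpace G]
    [LocallyCompactSpace G] (ha : 0 < a) (ha1 : a < 1) {f u : ℝ → G} (hu : Measurable u)
    (hfs : TopologicalSpace.IsSeparable (f '' Icc 0 1)) {W : Set ℝ} (hW1 : W ⊆ Ioc 0 1)
    (hW : ∀ z, ∀ x ∈ W, H a z x ∈ W) (hWae : ∀ᵐ x ∂mu, x ∈ W)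
    (hc : ∀ x ∈ W, f x = u x - u (lsv a x)) {ε : ℝ} (hε : 0 < ε) :
    ∃ A : Set ℝ, MeasurableSet A ∧ 0 < mu A ∧ ∀ x ∈ A, ∀ y ∈ A, dist (u x) (u y) ≤ ε := by
  obtain ⟨k, hk, hk0⟩ := exists_compact_mem_nhds (0 : G)
  set Hs : AddSubgroup G :=
    (Submodule.span ℤ (k ∪ f '' Icc 0 1)).toAddSubgroup.topologicalClosure with hHs
  have hsep : TopologicalSpace.IsSeparable (Hs : Set G) := by
    have h1 : TopologicalSpace.IsSeparable (Submodule.span ℤ (k ∪ f '' Icc 0 1) : Set G) :=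
      (hk.isSeparable.union hfs).span
    exact h1.closure
  have hin : ∀ x ∈ k ∪ f '' Icc 0 1, x ∈ Hs := fun x hx =>
    AddSubgroup.le_topologicalClosure _ (Submodule.subset_span hx)
  have hopen : IsOpen (Hs : Set G) := by
    refine AddSubgroup.isOpen_of_mem_nhds Hs (g := 0) (Filter.mem_of_superset hk0 ?_)
    intro x hx
    exact hin x (Or.inl hx)
  have hdisc : DiscreteTopology (G ⧸ Hs) := QuotientAddGroup.discreteTopology hopen
  set q : ℝ → G ⧸ Hs := fun x => (u x : G ⧸ Hs) with hq
  have hqm : ∀ B : Set (G ⧸ Hs), MeasurableSet (q ⁻¹' B) := by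
    intro B
    have : IsOpen ((QuotientAddGroup.mk : G → G ⧸ Hs) ⁻¹' B) :=
      (isOpen_discrete B).preimage continuous_quotient_mk'
    exact hu this.measurableSet
  have hqinv : ∀ z, ∀ x ∈ W, q (H a z x) = q x := by
    intro z x hx
    have h1 := hc _ (hW z x hx)
    rw [lsv_H ha z (hW1 hx)] at h1
    rw [hq]
    simp only
    rw [eq_comm, QuotientAddGroup.eq]
    have h2 : f (H a z x) ∈ Hs := hin _ (Or.inr ⟨_, ⟨(hW1 (hW z x hx)).1.le, (hW1 (hW z x hx)).2⟩, rfl⟩)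
    rw [h1] at h2
    rwa [neg_add_eq_sub]
  set e : ℝ → ℝ := fun x => Function.invFun q (q x) with he
  obtain ⟨c0, hc0⟩ := Filter.exists_eventuallyEq_const_of_forall_separating (f := e) (l := ae mu)
    MeasurableSet (by
      intro U hU
      have hm : MeasurableSet (e ⁻¹' U) := hqm (Function.invFun q ⁻¹' U)
      by_cases h0 : mu (e ⁻¹' U) = 0
      · right
        exact measure_eq_zero_iff_ae_notMem.1 h0
      · left
        refine zero_one (S := e ⁻¹' U) ha ha1 hW hWae hm ?_ (pos_iff_ne_zero.2 h0)
        intro z x hx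
        simp only [mem_preimage, he, hqinv z x hx])
  have hco : ∀ᵐ x ∂mu, u x - u c0 ∈ Hs := by
    filter_upwards [hc0] with x hx
    have h1 : q (e x) = q x := Function.invFun_eq ⟨x, rfl⟩
    rw [hx] at h1
    have h2 := (QuotientAddGroup.eq (s := Hs)).1 h1
    rwa [Function.const_apply, neg_add_eq_sub] at h2
  obtain ⟨d, hdc, hd⟩ := hsep
  have := hdc.to_subtype
  have hcov : mu (⋃ i : d, {x | dist (u x - u c0) i < ε/2}) ≠ 0 := by
    have h1 : ∀ᵐ x ∂mu, x ∈ ⋃ i : d, {x | dist (u x - u c0) i < ε/2} := by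
      filter_upwards [hco] with x hx
      obtain ⟨i, hi, hi2⟩ := Metric.mem_closure_iff.1 (hd hx) (ε/2) (by positivity)
      exact mem_iUnion.2 ⟨⟨i, hi⟩, hi2⟩
    have h2 : mu univ ≤ mu (⋃ i : d, {x | dist (u x - u c0) i < ε/2}) := by
      refine measure_mono_ae ?_
      filter_upwards [h1] with x hx _
      exact hx
    rw [mu_univ] at h2
    intro h3
    rw [h3] at h2
    simp at h2
  obtain ⟨i, hi⟩ := exists_measure_pos_of_not_measure_iUnion_null hcov
  refine ⟨_, ?_, hi, ?_⟩
  · have : IsOpen {w : G | dist (w - u c0) i < ε/2} :=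
      isOpen_lt (by fun_prop) continuous_const
    exact hu this.measurableSet
  · intro x hx y hy
    have hx : dist (u x - u c0) i < ε/2 := hx
    have hy : dist (u y - u c0) i < ε/2 := hy
    have := dist_triangle_right (u x - u c0) (u y - u c0) i
    rw [dist_sub_right] at this
    linarith

lemma osc_est {G : Type*} [NormedAddCommGroup G] [MeasurableSpace G] [BorelSpace G]
    [LocallyCompactSpace G] (ha : 0 < a) (ha1 : a < 1) {γ : ℝ} (hγ : 0 < γ)
    {f u : ℝ → G} (hu : Measurable u)
    (hfs : TopologicalSpace.IsSeparable (f '' Icc 0 1)) {Cf : ℝ} (hCf : 0 ≤ Cf)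
    (hf : ∀ x ∈ Ioc (0:ℝ) 1, ∀ y ∈ Ioc (0:ℝ) 1, (x ≤ 1/2 ↔ y ≤ 1/2) →
      dist (f x) (f y) ≤ Cf * |x - y| ^ γ) {W : Set ℝ} (hW1 : W ⊆ Ioc 0 1)
    (hW : ∀ z, ∀ x ∈ W, H a z x ∈ W) (hWae : ∀ᵐ x ∂mu, x ∈ W)
    (hc : ∀ x ∈ W, f x = u x - u (lsv a x)) {ε : ℝ} (hε : 0 < ε) :
    ∃ C : ℝ, ∃ P : Set ℝ, (∀ᵐ x ∂mu, x ∈ P) ∧ ∀ x ∈ P, ∀ y ∈ P,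
      dist (u x) (u y) ≤ ε + C * |x - y| ^ γ := by
  obtain ⟨A, hA, hA0, hAo⟩ := small_osc ha ha1 hu hfs hW1 hW hWae hc hε
  obtain ⟨z, hz, K, hK⟩ := density ha ha1 (κ := min a γ) (lt_min ha hγ) (min_le_left _ _) hA hA0
  choose n hn1 hn2 using fun k : ℕ => hK ((1/2)^k) (by positivity)
  have hbc : ∀ᵐ x, ∀ᶠ k in Filter.atTop, x ∉ {y | y ∈ Icc (0:ℝ) 1 ∧ g a (n k) z y ∉ A} := by
    refine ae_eventually_notMem (ne_top_of_le_ne_top ?_ (ENNReal.tsum_le_tsum hn2))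
    rw [← ENNReal.ofReal_tsum_of_nonneg (fun k => by positivity) summable_geometric_two]
    exact ENNReal.ofReal_ne_top
  refine ⟨Cf * Real.exp (4 * K) ^ γ * K, {x | x ∈ W ∧ ∀ᶠ k in Filter.atTop,
    x ∉ {y | y ∈ Icc (0:ℝ) 1 ∧ g a (n k) z y ∉ A}}, ?_, ?_⟩
  · filter_upwards [hWae, ae_restrict_of_ae hbc] with x h1 h2
    exact ⟨h1, h2⟩
  · rintro x ⟨hx, hx2⟩ y ⟨hy, hy2⟩
    obtain ⟨k, hkx, hky⟩ := (hx2.and hy2).exists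
    have hgx : g a (n k) z x ∈ A := by
      by_contra h; exact hkx ⟨⟨(hW1 hx).1.le, (hW1 hx).2⟩, h⟩
    have hgy : g a (n k) z y ∈ A := by
      by_contra h; exact hky ⟨⟨(hW1 hy).1.le, (hW1 hy).2⟩, h⟩
    have := cob_est (fun x y x' y' => dist_sub_sub_le x y x' y') ha ha1 (min_le_left _ _)
      (min_le_right _ _) hγ hCf hf hW1 hW hc (n k) z (hn1 k) x hx y hy
    refine this.trans (add_le_add (hAo _ hgx _ hgy) ?_)
    gcongr
    exact hn1 k

lemma holder_W {G : Type*} [NormedAddCommGroup G] [MeasurableSpace G] [BorelSpace G]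
    [LocallyCompactSpace G] (ha : 0 < a) (ha1 : a < 1) {γ : ℝ} (hγ : 0 < γ)
    {f u : ℝ → G} (hu : Measurable u)
    (hfs : TopologicalSpace.IsSeparable (f '' Icc 0 1)) {Cf : ℝ} (hCf : 0 ≤ Cf)
    (hf : ∀ x ∈ Ioc (0:ℝ) 1, ∀ y ∈ Ioc (0:ℝ) 1, (x ≤ 1/2 ↔ y ≤ 1/2) →
      dist (f x) (f y) ≤ Cf * |x - y| ^ γ)
    (hcob : ∀ᵐ x ∂mu, f x = u x - u (lsv a x)) :
    ∃ C : ℝ, 0 ≤ C ∧ ∃ W : Set ℝ, W ⊆ Ioc 0 1 ∧ (∀ᵐ x ∂mu, x ∈ W) ∧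
      (∀ x ∈ W, f x = u x - u (lsv a x)) ∧
      ∀ x ∈ W, ∀ y ∈ W, dist (u x) (u y) ≤ C * |x - y| ^ γ := by
  obtain ⟨W0, hW01, hW0N, hW0, hW0ae⟩ := exists_W ha ha1 (N := {x | ¬ (f x = u x - u (lsv a x))}) hcob
  have hc0 : ∀ x ∈ W0, f x = u x - u (lsv a x) := fun x hx => not_not.1 (hW0N x hx)
  choose C P hP hCP using fun m : ℕ => osc_est ha ha1 hγ hu hfs hCf hf hW01 hW0 hW0ae hc0
    (ε := 1/((m:ℝ)+1)) (by positivity)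
  have hall : ∀ᵐ x ∂mu, x ∈ W0 ∧ ∀ m, x ∈ P m := by
    filter_upwards [hW0ae, ae_all_iff.2 hP] with x h1 h2
    exact ⟨h1, h2⟩
  obtain ⟨W, hW1, hWN, hW, hWae⟩ := exists_W ha ha1 (N := {x | ¬ (x ∈ W0 ∧ ∀ m, x ∈ P m)}) hall
  have hWP : ∀ x ∈ W, x ∈ W0 ∧ ∀ m, x ∈ P m := fun x hx => not_not.1 (hWN x hx)
  set ρ : ℝ := (1/2:ℝ)^γ with hρ
  have hρ0 : 0 < ρ := by positivity
  have hρ1 : ρ < 1 := Real.rpow_lt_one (by norm_num) (by norm_num) hγ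
  set C' := Cf * ρ / (1 - ρ) with hC'
  have h1ρ : 0 < 1 - ρ := by linarith
  have hC'0 : 0 ≤ C' := by positivity
  have hC'e : C' = Cf * ρ + C' * ρ := by
    rw [hC']; field_simp; ring
  refine ⟨C', hC'0, W, hW1, hWae, fun x hx => hc0 x (hWP x hx).1, ?_⟩
  have hH : ∀ x, H a 1 x = (x+1)/2 := by intro x; simp only [H]; norm_num
  have step : ∀ x ∈ W, ∀ y ∈ W, dist (u x) (u y) - C' * |x - y|^γ ≤
      dist (u (H a 1 x)) (u (H a 1 y)) - C' * |H a 1 x - H a 1 y|^γ := by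
    intro x hx y hy
    have kx := hc0 _ (hWP _ (hW 1 x hx)).1
    have ky := hc0 _ (hWP _ (hW 1 y hy)).1
    rw [lsv_H ha 1 (hW1 hx)] at kx
    rw [lsv_H ha 1 (hW1 hy)] at ky
    have kf := hf _ (hW1 (hW 1 x hx)) _ (hW1 (hW 1 y hy))
      (by rw [H_side ha 1 (hW1 hx), H_side ha 1 (hW1 hy)])
    have hab : |H a 1 x - H a 1 y|^γ = ρ * |x - y|^γ := by
      rw [hH, hH, show (x+1)/2 - (y+1)/2 = (1/2) * (x - y) by ring, abs_mul,
        Real.mul_rpow (abs_nonneg _) (abs_nonneg _), abs_of_pos (by norm_num : (0:ℝ) < 1/2)]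
    have ht : dist (u x) (u y) ≤ dist (u (H a 1 x)) (u (H a 1 y)) +
        dist (f (H a 1 x)) (f (H a 1 y)) := by
      have e1 : u x = u (H a 1 x) - f (H a 1 x) := by rw [kx]; abel
      have e2 : u y = u (H a 1 y) - f (H a 1 y) := by rw [ky]; abel
      calc dist (u x) (u y) = dist (u (H a 1 x) - f (H a 1 x)) (u (H a 1 y) - f (H a 1 y)) := by
            rw [← e1, ← e2]
        _ ≤ _ := dist_sub_sub_le _ _ _ _
    rw [hab] at kf ⊢
    have : C' * |x - y|^γ = Cf * (ρ * |x-y|^γ) + C' * (ρ * |x-y|^γ) := by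
      conv_lhs => rw [hC'e]
      ring
    linarith
  have hWi : ∀ n, ∀ x ∈ W, (H a 1)^[n] x ∈ W := by
    intro n
    induction n with
    | zero => intro x hx; exact hx
    | succ n ih => intro x hx; rw [Function.iterate_succ_apply']; exact hW 1 _ (ih x hx)
  have iter : ∀ n, ∀ x ∈ W, ∀ y ∈ W, dist (u x) (u y) - C' * |x - y|^γ ≤
      dist (u ((H a 1)^[n] x)) (u ((H a 1)^[n] y)) - C' * |(H a 1)^[n] x - (H a 1)^[n] y|^γ := by
    intro n
    induction n with
    | zero => intro x _ y _; exact le_rfl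
    | succ n ih =>
      intro x hx y hy
      rw [Function.iterate_succ_apply', Function.iterate_succ_apply']
      exact (ih x hx y hy).trans (step _ (hWi n x hx) _ (hWi n y hy))
  have hdist : ∀ n x y, (H a 1)^[n] x - (H a 1)^[n] y = (1/2)^n * (x - y) := by
    intro n x y
    induction n with
    | zero => simp
    | succ n ih =>
      rw [Function.iterate_succ_apply', Function.iterate_succ_apply', hH, hH, pow_succ]
      linear_combination ih / 2
  intro x hx y hy
  have key : ∀ m : ℕ, dist (u x) (u y) - C' * |x - y|^γ ≤ 1/((m:ℝ)+1) := by
    intro m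
    have l1 : Filter.Tendsto (fun n : ℕ => 1/((m:ℝ)+1) + C m * |(1/2)^n * (x - y)|^γ) Filter.atTop
        (nhds (1/((m:ℝ)+1) + C m * |0 * (x - y)|^γ)) := by
      have h1 : Filter.Tendsto (fun n : ℕ => ((1/2:ℝ))^n) Filter.atTop (nhds 0) :=
        tendsto_pow_atTop_nhds_zero_of_lt_one (by norm_num) (by norm_num)
      exact ((((h1.mul_const (x - y)).abs).rpow_const (Or.inr hγ.le)).const_mul (C m)).const_add _
    simp only [zero_mul, abs_zero, Real.zero_rpow hγ.ne', mul_zero, add_zero] at l1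
    refine ge_of_tendsto' l1 fun n => ?_
    have h1 := iter n x hx y hy
    have h2 := hCP m _ ((hWP _ (hWi n x hx)).2 m) _ ((hWP _ (hWi n y hy)).2 m)
    rw [hdist] at h1 h2
    have h3 : 0 ≤ C' * |(1/2)^n * (x - y)|^γ := by positivity
    linarith
  have := ge_of_tendsto' (tendsto_one_div_add_atTop_nhds_zero_nat (𝕜 := ℝ)) key
  linarith

end
end LSV

open MeasureTheory Set
namespace LSV

section
variable {a : ℝ}

lemma exists_seq {P : Set ℝ} (hP : ∀ᵐ x ∂mu, x ∈ P) {p q x : ℝ} (hp : 0 ≤ p) (hpq : p < q)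
    (hq : q ≤ 1) (hx : x ∈ Icc p q) :
    ∃ s : ℕ → ℝ, (∀ k, s k ∈ P ∧ s k ∈ Ioo p q) ∧ Filter.Tendsto s Filter.atTop (nhds x) := by
  have key : ∀ ε > 0, ∃ y, (y ∈ P ∧ y ∈ Ioo p q) ∧ |y - x| ≤ ε := by
    intro ε hε
    have hlt : max p (x - ε) < min q (x + ε) := by
      rw [lt_min_iff, max_lt_iff, max_lt_iff]
      refine ⟨⟨hpq, by linarith [hx.2]⟩, by linarith [hx.1], by linarith⟩
    have hsub : Ioo (max p (x - ε)) (min q (x + ε)) ⊆ Icc 0 1 := by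
      intro y hy
      exact ⟨by linarith [le_max_left p (x - ε), hy.1], by linarith [min_le_left q (x + ε), hy.2]⟩
    have hpos : mu (Ioo (max p (x - ε)) (min q (x + ε))) ≠ 0 := by
      rw [mu_apply, inter_eq_left.2 hsub, Real.volume_Ioo]
      exact (ENNReal.ofReal_pos.2 (sub_pos.2 hlt)).ne'
    obtain ⟨y, hy1, hy2⟩ := ((frequently_ae_mem_iff.2 hpos).and_eventually hP).exists
    have h1 := le_max_left p (x - ε)
    have h2 := le_max_right p (x - ε)
    have h3 := min_le_left q (x + ε)
    have h4 := min_le_right q (x + ε)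
    refine ⟨y, ⟨hy2, ⟨by linarith [hy1.1], by linarith [hy1.2]⟩⟩, ?_⟩
    rw [abs_le]
    constructor <;> linarith [hy1.1, hy1.2]
  choose s hs1 hs2 using fun k : ℕ => key (1/((k:ℝ)+1)) (by positivity)
  refine ⟨s, hs1, ?_⟩
  rw [tendsto_iff_dist_tendsto_zero]
  exact squeeze_zero (fun _ => dist_nonneg) (fun k => by rw [Real.dist_eq]; exact hs2 k)
    tendsto_one_div_add_atTop_nhds_zero_nat

theorem core {G : Type*} [NormedAddCommGroup G] [MeasurableSpace G] [BorelSpace G]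
    [LocallyCompactSpace G]
    (a : ℝ) (ha : 0 < a) (ha1 : a < 1)
    (γ : ℝ) (hγ : 0 < γ)
    (f u : ℝ → G) (hu : Measurable u)
    (hf1 : ∃ C : ℝ, ∀ x ∈ Icc (0:ℝ) (1/2), ∀ y ∈ Icc (0:ℝ) (1/2),
      dist (f x) (f y) ≤ C * |x - y| ^ γ)
    (hf2 : ∃ C : ℝ, ∀ x ∈ Ioc (1/2:ℝ) 1, ∀ y ∈ Ioc (1/2:ℝ) 1,
      dist (f x) (f y) ≤ C * |x - y| ^ γ)
    (hcob : ∀ᵐ x ∂(volume.restrict (Icc (0:ℝ) 1)), f x = u x - u (lsv a x)) :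
    ∃ v : ℝ → G,
      (∀ᵐ x ∂(volume.restrict (Icc (0:ℝ) 1)), v x = u x) ∧
      (∃ C : ℝ, ∀ x ∈ Icc (0:ℝ) 1, ∀ y ∈ Icc (0:ℝ) 1,
        dist (v x) (v y) ≤ C * |x - y| ^ γ) ∧
      (∀ x ∈ Icc (0:ℝ) 1, f x = v x - v (lsv a x)) := by
  obtain ⟨C1, hC1⟩ := hf1
  obtain ⟨C2, hC2⟩ := hf2
  have hfc1 := holder_cont hγ hC1
  have hfc2 := holder_cont hγ hC2
  have hfs : TopologicalSpace.IsSeparable (f '' Icc 0 1) := by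
    have h := (hfc1.isSeparable_image (TopologicalSpace.IsSeparable.of_separableSpace _)).union
      (hfc2.isSeparable_image (TopologicalSpace.IsSeparable.of_separableSpace _))
    refine h.mono ?_
    rintro _ ⟨x, hx, rfl⟩
    rcases le_or_gt x (1/2) with h' | h'
    · exact Or.inl ⟨x, ⟨hx.1, h'⟩, rfl⟩
    · exact Or.inr ⟨x, ⟨h', hx.2⟩, rfl⟩
  set Cf := max 0 (max C1 C2)
  have hCf : 0 ≤ Cf := le_max_left _ _
  have hf : ∀ x ∈ Ioc (0:ℝ) 1, ∀ y ∈ Ioc (0:ℝ) 1, (x ≤ 1/2 ↔ y ≤ 1/2) →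
      dist (f x) (f y) ≤ Cf * |x - y| ^ γ := by
    intro x hx y hy hxy
    have k1 : C1 ≤ Cf := (le_max_left _ _).trans (le_max_right _ _)
    have k2 : C2 ≤ Cf := (le_max_right _ _).trans (le_max_right _ _)
    by_cases h : x ≤ 1/2
    · refine (hC1 x ⟨hx.1.le, h⟩ y ⟨hy.1.le, hxy.1 h⟩).trans ?_
      gcongr
    · have h2 : ¬ y ≤ 1/2 := fun h' => h (hxy.2 h')
      push Not at h h2
      refine (hC2 x ⟨h, hx.2⟩ y ⟨h2, hy.2⟩).trans ?_
      gcongr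
  obtain ⟨C, hC0, W, hW1, hWae, hWc, hWh⟩ := holder_W ha ha1 hγ hu hfs hCf hf hcob
  have hcont : Continuous (fun t : ℝ => C * |t| ^ γ) := by
    have := Real.continuous_rpow_const (q := γ) hγ.le
    fun_prop
  have hex : ∀ x, ∃ l : G, x ∈ Icc (0:ℝ) 1 → ∃ s : ℕ → ℝ, (∀ k, s k ∈ W) ∧
      Filter.Tendsto s Filter.atTop (nhds x) ∧ Filter.Tendsto (fun k => u (s k)) Filter.atTop (nhds l) := by
    intro x
    by_cases hx : x ∈ Icc (0:ℝ) 1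
    · obtain ⟨s, hs1, hs2⟩ := exists_seq hWae le_rfl one_pos le_rfl hx
      have hcau : CauchySeq (fun k => u (s k)) := by
        rw [cauchySeq_iff_tendsto_dist_atTop_0]
        have h1 := hs2.comp (Filter.tendsto_fst (f := Filter.atTop) (g := (Filter.atTop : Filter ℕ)))
        have h2 := hs2.comp (Filter.tendsto_snd (f := (Filter.atTop : Filter ℕ)) (g := Filter.atTop))
        have h3 := (hcont.tendsto _).comp (h1.sub h2)
        rw [Filter.prod_atTop_atTop_eq] at h3
        simp only [sub_self, abs_zero, Real.zero_rpow hγ.ne', mul_zero] at h3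
        exact squeeze_zero (fun _ => dist_nonneg)
          (fun p => hWh _ (hs1 p.1).1 _ (hs1 p.2).1) h3
      have : CompleteSpace G := IsRightUniformAddGroup.completeSpace_of_weaklyLocallyCompactSpace
      obtain ⟨l, hl⟩ := cauchySeq_tendsto_of_complete hcau
      exact ⟨l, fun _ => ⟨s, fun k => (hs1 k).1, hs2, hl⟩⟩
    · exact ⟨0, fun h => absurd h hx⟩
  choose v hv using hex
  have hvh : ∀ x ∈ Icc (0:ℝ) 1, ∀ y ∈ Icc (0:ℝ) 1, dist (v x) (v y) ≤ C * |x - y| ^ γ := by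
    intro x hx y hy
    obtain ⟨s, hs1, hs2, hs3⟩ := hv x hx
    obtain ⟨t, ht1, ht2, ht3⟩ := hv y hy
    exact le_of_tendsto_of_tendsto' (hs3.dist ht3) ((hcont.tendsto _).comp (hs2.sub ht2))
      fun k => hWh _ (hs1 k) _ (ht1 k)
  have hvu : ∀ x ∈ W, v x = u x := by
    intro x hx
    obtain ⟨s, hs1, hs2, hs3⟩ := hv x ⟨(hW1 hx).1.le, (hW1 hx).2⟩
    have h1 := le_of_tendsto_of_tendsto' (hs3.dist (tendsto_const_nhds (x := u x)))
      ((hcont.tendsto _).comp (hs2.sub (tendsto_const_nhds (x := x))))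
      fun k => hWh _ (hs1 k) _ hx
    simp only [sub_self, abs_zero, Real.zero_rpow hγ.ne', mul_zero] at h1
    exact dist_le_zero.1 h1
  have hvc := holder_cont hγ hvh
  refine ⟨v, ?_, ⟨C, hvh⟩, ?_⟩
  · filter_upwards [hWae] with x hx
    exact hvu x hx
  have hWT : ∀ᵐ x ∂mu, x ∈ W ∩ {x | lsv a x ∈ W} := by
    have : mu {y | lsv a y ∈ Wᶜ} = 0 := null_lsv ha (N := Wᶜ) hWae
    have h2 : ∀ᵐ x ∂mu, x ∉ {y | lsv a y ∈ Wᶜ} := measure_eq_zero_iff_ae_notMem.1 this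
    filter_upwards [hWae, h2] with x h3 h4
    exact ⟨h3, not_not.1 h4⟩
  have hpt : ∀ x, x ∈ W ∩ {x | lsv a x ∈ W} → f x = v x - v (lsv a x) := by
    rintro x ⟨h1, h2⟩
    rw [hvu x h1, hvu _ h2]
    exact hWc x h1
  -- passing to the limit along a piece
  have pass : ∀ (J : Set ℝ) (τ : ℝ → ℝ), J ⊆ Icc 0 1 → ContinuousOn f J → Continuous τ →
      (∀ y ∈ J, lsv a y = τ y) → ∀ x ∈ J, ∀ s : ℕ → ℝ,
      (∀ k, s k ∈ W ∩ {x | lsv a x ∈ W} ∧ s k ∈ J) → Filter.Tendsto s Filter.atTop (nhds x) →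
      f x = v x - v (lsv a x) := by
    intro J τ hJ hfJ hτ hlτ x hx s hs hlim
    have l1 : Filter.Tendsto s Filter.atTop (nhdsWithin x J) :=
      tendsto_nhdsWithin_iff.2 ⟨hlim, Filter.Eventually.of_forall fun k => (hs k).2⟩
    have l2 : Filter.Tendsto s Filter.atTop (nhdsWithin x (Icc 0 1)) :=
      tendsto_nhdsWithin_iff.2 ⟨hlim, Filter.Eventually.of_forall fun k => hJ (hs k).2⟩
    have l3 : Filter.Tendsto (fun k => lsv a (s k)) Filter.atTop (nhdsWithin (lsv a x) (Icc 0 1)) := by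
      refine tendsto_nhdsWithin_iff.2 ⟨?_, Filter.Eventually.of_forall fun k =>
        lsv_mem ha (hJ (hs k).2)⟩
      rw [hlτ x hx]
      simp only [fun k => hlτ _ (hs k).2]
      exact (hτ.tendsto x).comp hlim
    have m1 := (hfJ x hx).tendsto.comp l1
    have m2 := (hvc x (hJ hx)).tendsto.comp l2
    have m3 := (hvc _ (lsv_mem ha (hJ hx))).tendsto.comp l3
    refine tendsto_nhds_unique m1 ((m2.sub m3).congr fun k => ?_)
    exact (hpt _ (hs k).1).symm
  intro x hx
  rcases le_or_gt x (1/2) with h | h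
  · obtain ⟨s, hs, hlim⟩ := exists_seq hWT (p := 0) (q := 1/2) le_rfl (by norm_num) (by norm_num)
      (⟨hx.1, h⟩ : x ∈ Icc 0 (1/2))
    exact pass (Icc 0 (1/2)) (TL a) (Icc_subset_Icc le_rfl (by norm_num)) hfc1 (TL_cont ha)
      (fun y hy => lsv_le hy.2) x ⟨hx.1, h⟩ s
      (fun k => ⟨(hs k).1, ⟨(hs k).2.1.le, (hs k).2.2.le⟩⟩) hlim
  · obtain ⟨s, hs, hlim⟩ := exists_seq hWT (p := 1/2) (q := 1) (by norm_num) (by norm_num) le_rfl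
      (⟨h.le, hx.2⟩ : x ∈ Icc (1/2) 1)
    exact pass (Ioc (1/2) 1) (fun y => 2 * y - 1) (fun y hy => ⟨by linarith [hy.1], hy.2⟩) hfc2
      (by fun_prop) (fun y hy => lsv_gt hy.1) x ⟨h, hx.2⟩ s
      (fun k => ⟨(hs k).1, ⟨(hs k).2.1, (hs k).2.2.le⟩⟩) hlim

end
end LSV

/-- Livšic regularity for the LSV intermittent map: if `f` is `γ`-Hölder on `[0,1/2]`
and on `(1/2,1]` and `f = u - u ∘ T` Lebesgue-a.e. on `[0,1]`, then `u` coincides a.e.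
with a `γ`-Hölder function `ũ` on `[0,1]` with `f = ũ - ũ ∘ T` everywhere on `[0,1]`. -/
theorem lsv_livsic_regularity {G : Type*}
    [MetricSpace G] [AddCommGroup G] [MeasurableSpace G] [BorelSpace G]
    [LocallyCompactSpace G]
    (hinv : ∀ g x y : G, dist (g + x) (g + y) = dist x y)
    (a : ℝ) (ha : 0 < a) (ha1 : a < 1)
    (γ : ℝ) (hγ : 0 < γ)
    (f u : ℝ → G) (hu : Measurable u)
    (hf1 : ∃ C : ℝ, ∀ x ∈ Icc (0:ℝ) (1/2), ∀ y ∈ Icc (0:ℝ) (1/2),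
      dist (f x) (f y) ≤ C * |x - y| ^ γ)
    (hf2 : ∃ C : ℝ, ∀ x ∈ Ioc (1/2:ℝ) 1, ∀ y ∈ Ioc (1/2:ℝ) 1,
      dist (f x) (f y) ≤ C * |x - y| ^ γ)
    (hcob : ∀ᵐ x ∂(volume.restrict (Icc (0:ℝ) 1)), f x = u x - u (lsv a x)) :
    ∃ v : ℝ → G,
      (∀ᵐ x ∂(volume.restrict (Icc (0:ℝ) 1)), v x = u x) ∧
      (∃ C : ℝ, ∀ x ∈ Icc (0:ℝ) 1, ∀ y ∈ Icc (0:ℝ) 1,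
        dist (v x) (v y) ≤ C * |x - y| ^ γ) ∧
      (∀ x ∈ Icc (0:ℝ) 1, f x = v x - v (lsv a x)) := by
  let inst : NormedAddCommGroup G :=
    { ‹MetricSpace G›, ‹AddCommGroup G› with
      norm := fun x => dist x 0
      dist_eq := by
        intro x y
        change dist x y = dist (-x + y) 0
        rw [← hinv x (-x + y) 0, add_neg_cancel_left, add_zero, dist_comm] }
  exact LSV.core a ha ha1 γ hγ f u hu hf1 hf2 hcob
end
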